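/- arXiv:2003.12000 — 4 statements merged into one kernel-verified Lean document; each statement's English description precedes it below -/
import Mathlib

section
/- Let M be a connected n-manifold with boundary ∂M. If the interior M − ∂M is metrisable, then ∂M is a 0-set in M, i.e. there is a continuous function f : M → ℝ with f⁻¹({0}) = ∂M. -/
open Set Topology unitInterval

variable {X : Type*} [TopologicalSpace X]

/-- `h : B × [0,1] → X` is a collar of `B` in `X`: an embedding with `h(x,0) = x`,
`h⁻¹(B) = B × {0}`, and `h(B × [0,1))` open in `X`. -/
def IsCollarMap (B : Set X) (h : B × I → X) : Prop :=
  Topology.IsEmbedding h ∧ (∀ x : B, h (x, 0) = (x : X)) ∧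
    h ⁻¹' B = {p : B × I | p.2 = 0} ∧ IsOpen (h '' {p : B × I | p.2 < 1})

/-- `B` is collared in `X`. -/
def IsCollared (B : Set X) : Prop := ∃ h : B × I → X, IsCollarMap B h

/-- `B` is strongly collared in `X`: the collar map can be chosen to be a closed map. -/
def IsStronglyCollared (B : Set X) : Prop :=
  ∃ h : B × I → X, IsCollarMap B h ∧ IsClosedMap h

/-- `x` has a neighbourhood homeomorphic to `ℝ^{n-1} × ℝ_{≥0}`. -/
def HasBoundaryChart (n : ℕ) (x : X) : Prop :=
  ∃ U : Set X, U ∈ nhds x ∧ Nonempty (U ≃ₜ ((Fin (n - 1) → ℝ) × {r : ℝ // 0 ≤ r}))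

/-- `x` has a neighbourhood homeomorphic to `ℝⁿ`. -/
def HasInteriorChart (n : ℕ) (x : X) : Prop :=
  ∃ U : Set X, U ∈ nhds x ∧ Nonempty (U ≃ₜ (Fin n → ℝ))

/-- An `n`-manifold with boundary: a Hausdorff space such that every point has a neighbourhood
homeomorphic to `ℝ^{n-1} × ℝ_{≥0}` (Hausdorffness is a separate instance hypothesis). -/
def IsManifoldWithBoundary (n : ℕ) (M : Type*) [TopologicalSpace M] : Prop :=
  ∀ x : M, HasBoundaryChart n x

/-- The boundary `∂M`: the points with no neighbourhood homeomorphic to `ℝⁿ`. -/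
def mBoundary (n : ℕ) (M : Type*) [TopologicalSpace M] : Set M :=
  {x : M | ¬ HasInteriorChart n x}

/-- A preconnected, paracompact, weakly locally compact space is `σ`-compact. -/
theorem sigmaCompactSpace_of_preconnected_paracompact (Y : Type*) [TopologicalSpace Y]
    [PreconnectedSpace Y] [ParacompactSpace Y] [WeaklyLocallyCompactSpace Y] :
    SigmaCompactSpace Y := by
  rcases isEmpty_or_nonempty Y with hY | ⟨⟨y₀⟩⟩
  · infer_instance
  choose C hC hCn using fun y : Y => exists_compact_mem_nhds y
  obtain ⟨v, vo, vc, vl, vC⟩ := precise_refinement (fun y => interior (C y))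
    (fun y => isOpen_interior)
    (iUnion_eq_univ_iff.2 fun y => ⟨y, mem_interior_iff_mem_nhds.2 (hCn y)⟩)
  let next : Set Y → Set Y := fun K => ⋃ i ∈ {i | (v i ∩ K).Nonempty}, C i
  let K : ℕ → Set Y := fun k => next^[k] {y₀}
  have hK : ∀ k, K (k + 1) = next (K k) := fun k => Function.iterate_succ_apply' _ _ _
  have hKc : ∀ k, IsCompact (K k) := by
    intro k
    induction k with
    | zero => exact isCompact_singleton
    | succ k ih =>
      rw [hK]
      exact (vl.finite_nonempty_inter_compact ih).isCompact_biUnion fun i _ => hC i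
  have hstep : ∀ i k, (v i ∩ K k).Nonempty → v i ⊆ ⋃ k, K k := by
    intro i k hik z hz
    refine mem_iUnion.2 ⟨k + 1, ?_⟩
    rw [hK]
    exact mem_biUnion (show i ∈ {i | (v i ∩ K k).Nonempty} from hik) (interior_subset (vC i hz))
  have hcover : ∀ y, ∃ i, y ∈ v i := iUnion_eq_univ_iff.1 vc
  have hopen : IsOpen (⋃ k, K k) := by
    refine isOpen_iff_mem_nhds.2 fun y hy => ?_
    obtain ⟨k, hk⟩ := mem_iUnion.1 hy
    obtain ⟨i, hi⟩ := hcover y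
    exact Filter.mem_of_superset ((vo i).mem_nhds hi) (hstep i k ⟨y, hi, hk⟩)
  have hclosed : IsClosed (⋃ k, K k) := by
    refine isClosed_of_closure_subset fun y hy => ?_
    obtain ⟨i, hi⟩ := hcover y
    obtain ⟨z, hz, hzK⟩ := mem_closure_iff.1 hy _ (vo i) hi
    obtain ⟨k, hk⟩ := mem_iUnion.1 hzK
    exact hstep i k ⟨z, hz, hk⟩ hi
  have huniv : ⋃ k, K k = univ :=
    IsClopen.eq_univ ⟨hclosed, hopen⟩ ⟨y₀, mem_iUnion.2 ⟨0, rfl⟩⟩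
  exact ⟨⟨K, hKc, huniv⟩⟩

/-- If an open subset `O` of a Hausdorff space is locally compact and `σ`-compact, then its
complement is a zero set. -/
theorem exists_zeroSet_compl_of_sigmaCompact {Y : Type*} [TopologicalSpace Y] [T2Space Y]
    {O : Set Y} (hO : IsOpen O) [LocallyCompactSpace O] [SigmaCompactSpace O] :
    ∃ f : Y → ℝ, Continuous f ∧ f ⁻¹' {0} = Oᶜ := by
  classical
  have hGδ : IsGδ ({OnePoint.infty} : Set (OnePoint O)) := by
    have : ({OnePoint.infty} : Set (OnePoint O)) =
        ⋂ k, (((↑) : O → OnePoint O) '' compactCovering O k)ᶜ := by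
      rw [← compl_iUnion, ← image_iUnion, iUnion_compactCovering, image_univ,
        OnePoint.compl_range_coe]
    rw [this]
    exact IsGδ.iInter_of_isOpen fun k => OnePoint.isOpen_compl_image_coe.2
      ⟨(isCompact_compactCovering O k).isClosed, isCompact_compactCovering O k⟩
  obtain ⟨g, hg, -⟩ := exists_continuous_one_zero_of_isCompact_of_isGδ
    (isCompact_singleton (x := (OnePoint.infty : OnePoint O))) hGδ isClosed_empty
    (disjoint_empty _)
  let q : Y → OnePoint O := fun y => if h : y ∈ O then ((⟨y, h⟩ : O) : OnePoint O)
    else OnePoint.infty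
  have hqO : ∀ y (h : y ∈ O), q y = ((⟨y, h⟩ : O) : OnePoint O) := fun y h => dif_pos h
  have hqn : ∀ y, y ∉ O → q y = OnePoint.infty := fun y h => dif_neg h
  have hq : Continuous q := by
    refine continuous_def.2 fun s hs => ?_
    by_cases hinf : OnePoint.infty ∈ s
    · have hcpt := ((OnePoint.isOpen_iff_of_mem hinf).1 hs).2
      have : q ⁻¹' s = (((↑) : O → Y) '' (((↑) : O → OnePoint O) ⁻¹' s)ᶜ)ᶜ := by
        ext y
        by_cases hy : y ∈ O
        · simp [hqO y hy, hy]
        · simp [hqn y hy, hy, hinf]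
      rw [this]
      exact (hcpt.image continuous_subtype_val).isClosed.isOpen_compl
    · have : q ⁻¹' s = ((↑) : O → Y) '' (((↑) : O → OnePoint O) ⁻¹' s) := by
        ext y
        by_cases hy : y ∈ O
        · simp [hqO y hy, hy]
        · simp [hqn y hy, hy, hinf]
      rw [this]
      exact hO.isOpenMap_subtype_val _ ((OnePoint.isOpen_iff_of_notMem hinf).1 hs)
  refine ⟨fun y => 1 - g (q y), by fun_prop, ?_⟩
  ext y
  have h1 : g (q y) = 1 ↔ q y = OnePoint.infty := by
    rw [← mem_singleton_iff (b := (OnePoint.infty : OnePoint O)), hg]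
    rfl
  rw [mem_preimage, mem_singleton_iff, sub_eq_zero, eq_comm, h1]
  by_cases hy : y ∈ O
  · simp [hqO y hy, hy]
  · simp [hqn y hy, hy]

/-- A dense subset of a preconnected space is preconnected if every point has a neighbourhood
whose trace on it is preconnected. -/
theorem Dense.isPreconnected_of_nhds {Y : Type*} [TopologicalSpace Y]
    [PreconnectedSpace Y] {O : Set Y} (hO : Dense O)
    (h : ∀ x, ∃ V ∈ 𝓝 x, IsPreconnected (V ∩ O)) : IsPreconnected O := by
  intro A B hA hB hAB hOA hOB
  have hcov : (univ : Set Y) ⊆ closure (O ∩ A) ∪ closure (O ∩ B) := by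
    rw [← closure_union, ← inter_union_distrib_left, inter_eq_left.2 hAB, hO.closure_eq]
  obtain ⟨x, -, hxA, hxB⟩ := isPreconnected_closed_iff.1 isPreconnected_univ _ _ isClosed_closure
    isClosed_closure hcov (by simpa using hOA.closure) (by simpa using hOB.closure)
  obtain ⟨V, hV, hVO⟩ := h x
  refine (hVO A B hA hB (inter_subset_right.trans hAB) ?_ ?_).mono
    (inter_subset_inter_left _ inter_subset_right)
  · simpa [inter_assoc] using mem_closure_iff_nhds.1 hxA V hV
  · simpa [inter_assoc] using mem_closure_iff_nhds.1 hxB V hV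

/-- The interior of a space, in the sense of `n`-dimensional charts, is open. -/
theorem isOpen_compl_mBoundary (n : ℕ) (M : Type*) [TopologicalSpace M] :
    IsOpen (mBoundary n M)ᶜ := by
  refine isOpen_iff_mem_nhds.2 fun x hx => ?_
  obtain ⟨U, hU, e⟩ := not_not.1 hx
  filter_upwards [eventually_mem_nhds_iff.2 hU] with y hy
  exact not_not.2 ⟨U, hy, e⟩

/-- The interior of a Hausdorff space, in the sense of `n`-dimensional charts, is locally compact. -/
theorem locallyCompactSpace_compl_mBoundary (n : ℕ) (M : Type*) [TopologicalSpace M] [T2Space M] :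
    LocallyCompactSpace ↥(mBoundary n M)ᶜ := by
  suffices WeaklyLocallyCompactSpace ↥(mBoundary n M)ᶜ from inferInstance
  refine ⟨fun ⟨x, hx⟩ => ?_⟩
  obtain ⟨U, hU, ⟨e⟩⟩ := not_not.1 hx
  have : LocallyCompactSpace U := e.isClosedEmbedding.locallyCompactSpace
  have hO : ((↑) : U → M) ⁻¹' (mBoundary n M)ᶜ ∈ 𝓝 (⟨x, mem_of_mem_nhds hU⟩ : U) :=
    continuous_subtype_val.continuousAt.preimage_mem_nhds
      ((isOpen_compl_mBoundary n M).mem_nhds hx)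
  obtain ⟨s, hs, hsO, hsc⟩ := local_compact_nhds hO
  have hsub : ((↑) : U → M) '' s ⊆ (mBoundary n M)ᶜ := image_subset_iff.2 hsO
  refine ⟨(↑) ⁻¹' (((↑) : U → M) '' s), ?_, ?_⟩
  · refine Topology.IsInducing.subtypeVal.isCompact_preimage_iff ?_ |>.2
      (hsc.image continuous_subtype_val)
    rwa [Subtype.range_coe]
  · refine continuous_subtype_val.continuousAt.preimage_mem_nhds ?_
    rw [← map_nhds_subtype_coe_eq_nhds (mem_of_mem_nhds hU) hU]
    exact Filter.image_mem_map hs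

/-- A point has an interior chart if a copy of `ℝⁿ` embeds onto one of its neighbourhoods. -/
theorem hasInteriorChart_of_isEmbedding {n : ℕ} {E M : Type*} [TopologicalSpace E]
    [TopologicalSpace M] (e : E ≃ₜ (Fin n → ℝ)) {g : E → M} (hg : Topology.IsEmbedding g) {x : M}
    (hx : range g ∈ 𝓝 x) : HasInteriorChart n x :=
  ⟨range g, hx, ⟨hg.toHomeomorph.symm.trans e⟩⟩

/-- Points of positive last coordinate in a half-space chart are interior points. -/
theorem hasInteriorChart_of_pos {m : ℕ} {M : Type*} [TopologicalSpace M] {U : Set M}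
    (φ : U ≃ₜ ((Fin m → ℝ) × {r : ℝ // 0 ≤ r})) {z : U} (hU : U ∈ 𝓝 (z : M))
    (hz : 0 < ((φ z).2 : ℝ)) : HasInteriorChart (m + 1) (z : M) := by
  let ψ : (Fin m → ℝ) × {r : ℝ // 0 ≤ r} → (Fin m → ℝ) × ℝ := Prod.map id (↑)
  have hψ : Topology.IsEmbedding ψ := Topology.IsEmbedding.id.prodMap .subtypeVal
  have hpos : IsOpen {p : (Fin m → ℝ) × ℝ | 0 < p.2} := isOpen_lt continuous_const continuous_snd
  obtain ⟨ε, hε, hball⟩ := Metric.isOpen_iff.1 hpos (ψ (φ z)) hz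
  let b := OpenPartialHomeomorph.univBall (ψ (φ z)) ε
  have hb : Topology.IsEmbedding b :=
    (b.isOpenEmbedding (OpenPartialHomeomorph.univBall_source _ _)).isEmbedding
  have hbr : range b = Metric.ball (ψ (φ z)) ε := by
    rw [← image_univ, ← OpenPartialHomeomorph.univBall_source (ψ (φ z)) ε,
      b.image_source_eq_target, OpenPartialHomeomorph.univBall_target _ hε]
  have hb0 : ∀ p, 0 ≤ (b p).2 := fun p =>
    le_of_lt (hball (hbr ▸ mem_range_self p) : 0 < (b p).2)
  let c : (Fin m → ℝ) × ℝ → (Fin m → ℝ) × {r : ℝ // 0 ≤ r} := fun p => ((b p).1, ⟨(b p).2, hb0 p⟩)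
  have hcont : Continuous c := by
    have := hb.continuous
    fun_prop
  have hc : Topology.IsEmbedding c :=
    Topology.IsEmbedding.of_comp hcont hψ.continuous (by exact hb)
  have e : ((Fin m → ℝ) × ℝ) ≃ₜ (Fin (m + 1) → ℝ) :=
    (ContinuousLinearEquiv.ofFinrankEq (𝕜 := ℝ) (by simp)).toHomeomorph
  refine hasInteriorChart_of_isEmbedding e
    (Topology.IsEmbedding.subtypeVal.comp (φ.symm.isEmbedding.comp hc)) ?_
  rw [← map_nhds_subtype_coe_eq_nhds (mem_of_mem_nhds hU) hU, range_comp]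
  refine Filter.image_mem_map ?_
  have hnear : (fun y => ψ (φ y)) ⁻¹' Metric.ball (ψ (φ z)) ε ∈ 𝓝 z :=
    (hψ.continuous.comp φ.continuous).continuousAt.preimage_mem_nhds (Metric.ball_mem_nhds _ hε)
  refine Filter.mem_of_superset hnear fun y hy => ?_
  obtain ⟨p, hp⟩ : ψ (φ y) ∈ range b := hbr ▸ hy
  refine ⟨p, φ.symm_apply_eq.2 (hψ.injective hp)⟩

/-- Every point of a half-space chart has a neighbourhood with a preconnected dense subset made
of interior points. -/
theorem exists_nhds_dense_interior {m : ℕ} {M : Type*} [TopologicalSpace M] {x : M}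
    (hx : HasBoundaryChart (m + 1) x) :
    ∃ V ∈ 𝓝 x, ∃ W ⊆ V, V ⊆ closure W ∧ IsPreconnected W ∧ W ⊆ (mBoundary (m + 1) M)ᶜ := by
  obtain ⟨U, hU, ⟨φ⟩⟩ := hx
  let φ : U ≃ₜ ((Fin m → ℝ) × {r : ℝ // 0 ≤ r}) := φ
  let x' : U := ⟨x, mem_of_mem_nhds hU⟩
  let ψ : U → (Fin m → ℝ) × ℝ := fun y => ((φ y).1, (φ y).2)
  have hψ : Topology.IsEmbedding ψ :=
    (Topology.IsEmbedding.id.prodMap Topology.IsEmbedding.subtypeVal).comp φ.isEmbedding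
  let k : (Fin m → ℝ) × ℝ → M := fun p => φ.symm (p.1, ⟨max p.2 0, le_max_right _ _⟩)
  have hk : Continuous k := by
    have := φ.symm.continuous
    fun_prop
  have hkψ : ∀ y : U, k (ψ y) = y := fun y => by
    have : max ((φ y).2 : ℝ) 0 = (φ y).2 := max_eq_left (φ y).2.2
    simp [k, ψ, this]
  have hint : ((↑) : U → M) ⁻¹' interior U ∈ 𝓝 x' :=
    continuous_subtype_val.continuousAt.preimage_mem_nhds (interior_mem_nhds.2 hU)
  rw [hψ.nhds_eq_comap] at hint
  obtain ⟨t, ht, htU⟩ := Filter.mem_comap.1 hint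
  obtain ⟨ε, hε, hball⟩ := Metric.mem_nhds_iff.1 ht
  let D : Set ((Fin m → ℝ) × ℝ) := Metric.ball (ψ x') ε ∩ {p | 0 ≤ p.2}
  let D' : Set ((Fin m → ℝ) × ℝ) := Metric.ball (ψ x') ε ∩ {p | 0 < p.2}
  have hDD : D' ⊆ D := inter_subset_inter_right _ fun p (hp : 0 < p.2) => hp.le
  have hdense : D ⊆ closure D' := by
    rintro p ⟨hp, hp0⟩
    have hlim : Filter.Tendsto (fun s : ℝ => (p.1, p.2 + s)) (𝓝[>] 0) (𝓝 p) := by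
      have : Continuous fun s : ℝ => (p.1, p.2 + s) := by fun_prop
      simpa using (this.tendsto 0).mono_left nhdsWithin_le_nhds
    refine mem_closure_of_tendsto hlim ?_
    filter_upwards [hlim.eventually (Metric.isOpen_ball.mem_nhds hp), self_mem_nhdsWithin]
      with s hs hs0
    exact ⟨hs, show 0 < p.2 + s from add_pos_of_nonneg_of_pos hp0 hs0⟩
  have hconv : Convex ℝ D' :=
    (convex_ball _ _).inter (convex_halfSpace_gt (LinearMap.isLinear (LinearMap.snd ℝ _ ℝ)) 0)
  refine ⟨k '' D, ?_, k '' D', image_mono hDD,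
    (image_mono hdense).trans (image_closure_subset_closure_image hk),
    hconv.isPreconnected.image _ hk.continuousOn, ?_⟩
  · change k '' D ∈ 𝓝 (x' : M)
    rw [← map_nhds_subtype_coe_eq_nhds (mem_of_mem_nhds hU) hU]
    have hnear : ψ ⁻¹' Metric.ball (ψ x') ε ∈ 𝓝 x' :=
      hψ.continuous.continuousAt.preimage_mem_nhds (Metric.ball_mem_nhds _ hε)
    refine Filter.mem_map.2 (Filter.mem_of_superset hnear fun y hy => ?_)
    exact ⟨ψ y, ⟨hy, (φ y).2.2⟩, hkψ y⟩
  · rintro _ ⟨p, ⟨hp, hp0 : 0 < p.2⟩, rfl⟩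
    let y : U := φ.symm (p.1, ⟨max p.2 0, le_max_right _ _⟩)
    have hy : ψ y = p := by simp [ψ, y, hp0.le]
    have hyU : U ∈ 𝓝 (y : M) := mem_interior_iff_mem_nhds.1 (htU (a := y) (by
      rw [mem_preimage, hy]
      exact hball hp))
    exact not_not.2 (hasInteriorChart_of_pos φ hyU (by
      rw [← hy] at hp0
      exact hp0))

/-- In dimension `0`, the half-space convention leaves no interior points. -/
theorem mBoundary_zero_eq_univ {M : Type*} [TopologicalSpace M] [T2Space M] [PreconnectedSpace M]
    (hM : IsManifoldWithBoundary 0 M) : mBoundary 0 M = univ := by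
  refine eq_univ_of_forall fun x ⟨U, hU, ⟨e⟩⟩ => ?_
  have hUx : U = {x} := by
    have : Subsingleton U := e.injective.subsingleton
    exact (subsingleton_coe U |>.1 this).eq_singleton_of_mem (mem_of_mem_nhds hU)
  have huniv : ({x} : Set M) = univ :=
    IsClopen.eq_univ ⟨isClosed_singleton, isOpen_singleton_iff_nhds_eq_pure x |>.2
      (le_antisymm (Filter.le_pure_iff.2 (hUx ▸ hU)) (pure_le_nhds x))⟩ (singleton_nonempty x)
  have : Subsingleton M := subsingleton_univ_iff.1 (huniv ▸ subsingleton_singleton)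
  obtain ⟨V, -, ⟨φ⟩⟩ := hM x
  have h01 := congrArg (fun p => (p.2 : ℝ)) (φ.symm.injective (Subsingleton.elim
    (φ.symm (0, ⟨0, le_rfl⟩)) (φ.symm (0, ⟨1, zero_le_one⟩))))
  exact zero_ne_one h01

/-- If `M` is a connected `n`-manifold with boundary whose interior `M − ∂M` is metrisable,
then `∂M` is a `0`-set in `M`. -/
theorem boundary_zeroSet_of_metrizable_interior (n : ℕ) (M : Type*) [TopologicalSpace M]
    [T2Space M] [ConnectedSpace M] (hM : IsManifoldWithBoundary n M)
    (hint : TopologicalSpace.MetrizableSpace ↥((mBoundary n M)ᶜ)) :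
    ∃ f : M → ℝ, Continuous f ∧ f ⁻¹' {0} = mBoundary n M := by
  rcases n with _ | m
  · exact ⟨0, continuous_const, by rw [mBoundary_zero_eq_univ hM]; ext; simp⟩
  have hopen := isOpen_compl_mBoundary (m + 1) M
  have hdense : Dense (mBoundary (m + 1) M)ᶜ := fun x => by
    obtain ⟨V, hV, W, -, hVW, -, hW⟩ := exists_nhds_dense_interior (hM x)
    exact closure_mono hW (hVW (mem_of_mem_nhds hV))
  have hconn : IsPreconnected (mBoundary (m + 1) M)ᶜ := by
    refine hdense.isPreconnected_of_nhds fun x => ?_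
    obtain ⟨V, hV, W, hWV, hVW, hWc, hW⟩ := exists_nhds_dense_interior (hM x)
    exact ⟨V, hV, hWc.subset_closure (subset_inter hWV hW) (inter_subset_left.trans hVW)⟩
  have := isPreconnected_iff_preconnectedSpace.1 hconn
  have := locallyCompactSpace_compl_mBoundary (m + 1) M
  have : ParacompactSpace ↥(mBoundary (m + 1) M)ᶜ := by
    let := TopologicalSpace.metrizableSpaceMetric ↥(mBoundary (m + 1) M)ᶜ
    infer_instance
  have := sigmaCompactSpace_of_preconnected_paracompact ↥(mBoundary (m + 1) M)ᶜ
  simpa using exists_zeroSet_compl_of_sigmaCompact hopen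
end

section
/- Let M be a connected n-manifold with boundary ∂M whose interior M − ∂M is metrisable. Then at most countably many connected components of ∂M are compact. -/
open Set Topology unitInterval

variable {X : Type*} [TopologicalSpace X]

/-- A connected, weakly locally compact, paracompact Hausdorff space is `σ`-compact. -/
theorem sigmaCompactSpace_of_paracompact_of_preconnected {Y : Type*} [TopologicalSpace Y]
    [T2Space Y] [PreconnectedSpace Y] [WeaklyLocallyCompactSpace Y] [ParacompactSpace Y] :
    SigmaCompactSpace Y := by
  rcases isEmpty_or_nonempty Y with hY | ⟨⟨y₀⟩⟩
  · infer_instance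
  choose K hKc hKn using fun y : Y => exists_compact_mem_nhds y
  obtain ⟨v, hvo, hvU, hvf, hvK⟩ := precise_refinement (fun y => interior (K y))
    (fun _ => isOpen_interior)
    (eq_univ_of_forall fun y => mem_iUnion.2 ⟨y, mem_interior_iff_mem_nhds.2 (hKn y)⟩)
  have hvc : ∀ y, IsCompact (closure (v y)) := fun y =>
    (hKc y).closure_of_subset ((hvK y).trans interior_subset)
  have cover : ∀ y, ∃ i, y ∈ v i := fun y => by
    simpa using hvU.symm.subset (mem_univ y)
  let step : Set Y → Set Y := fun A => ⋃ i ∈ {i | (v i ∩ A).Nonempty}, closure (v i)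
  have hstep : ∀ A, IsCompact A → IsCompact (step A) := fun A hA =>
    (hvf.finite_nonempty_inter_compact hA).isCompact_biUnion fun i _ => hvc i
  let A : ℕ → Set Y := fun k => step^[k] {y₀}
  have hAsucc : ∀ k, A (k + 1) = step (A k) := fun k => Function.iterate_succ_apply' _ _ _
  have hAc : ∀ k, IsCompact (A k) := fun k => by
    induction k with
    | zero => exact isCompact_singleton
    | succ k ih => rw [hAsucc]; exact hstep _ ih
  have key : ∀ k i, (v i ∩ A k).Nonempty → v i ⊆ ⋃ k, A k := fun k i hi => by
    refine subset_closure.trans (Subset.trans ?_ (subset_iUnion A (k + 1)))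
    rw [hAsucc]
    exact subset_biUnion_of_mem (u := fun i => closure (v i)) hi
  have hclopen : IsClopen (⋃ k, A k) := by
    constructor
    · refine isClosed_of_closure_subset fun y hy => ?_
      obtain ⟨i, hi⟩ := cover y
      obtain ⟨z, hzv, hz⟩ := mem_closure_iff.1 hy (v i) (hvo i) hi
      obtain ⟨k, hk⟩ := mem_iUnion.1 hz
      exact key k i ⟨z, hzv, hk⟩ hi
    · refine isOpen_iff_mem_nhds.2 fun y hy => ?_
      obtain ⟨k, hk⟩ := mem_iUnion.1 hy
      obtain ⟨i, hi⟩ := cover y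
      exact Filter.mem_of_superset ((hvo i).mem_nhds hi) (key k i ⟨y, hi, hk⟩)
  exact ⟨A, hAc, hclopen.eq_univ ⟨y₀, mem_iUnion.2 ⟨0, rfl⟩⟩⟩

/-- If an open preconnected set `W` is locally not disconnected by `B`, then `W \ B` is
preconnected. -/
theorem IsPreconnected.diff_of_locally {M : Type*} [TopologicalSpace M] {B W : Set M}
    (h : ∀ x : M, ∀ V ∈ 𝓝 x, ∃ U ⊆ V, IsOpen U ∧ x ∈ U ∧ IsPreconnected (U \ B) ∧
      U ⊆ closure (U \ B))
    (hB : IsClosed B) (hW : IsPreconnected W) (hWo : IsOpen W) : IsPreconnected (W \ B) := by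
  intro u v hu hv huv hsu hsv
  have hso : IsOpen (W \ B) := hWo.sdiff hB
  have hcl : W ⊆ closure ((W \ B) ∩ u) ∪ closure ((W \ B) ∩ v) := by
    intro x hx
    rw [← closure_union, ← inter_union_distrib_left, inter_eq_left.2 huv]
    obtain ⟨U, hUW, -, hxU, -, hUc⟩ := h x W (hWo.mem_nhds hx)
    exact closure_mono (sdiff_subset_sdiff_left hUW) (hUc hxU)
  obtain ⟨x, hxW, hxu, hxv⟩ := isPreconnected_closed_iff.1 hW _ _ isClosed_closure
    isClosed_closure hcl
    (hsu.mono fun y hy => ⟨hy.1.1, subset_closure hy⟩)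
    (hsv.mono fun y hy => ⟨hy.1.1, subset_closure hy⟩)
  obtain ⟨U, hUW, hUo, hxU, hUp, -⟩ := h x W (hWo.mem_nhds hxW)
  obtain ⟨y, hyU, hy⟩ := mem_closure_iff.1 hxu U hUo hxU
  obtain ⟨z, hzU, hz⟩ := mem_closure_iff.1 hxv U hUo hxU
  have hsub : U \ B ⊆ W \ B := sdiff_subset_sdiff_left hUW
  exact (hUp u v hu hv (hsub.trans huv) ⟨y, ⟨hyU, hy.1.2⟩, hy.2⟩ ⟨z, ⟨hzU, hz.1.2⟩, hz.2⟩).mono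
    (inter_subset_inter_left _ hsub)

/-- Let `B` be a closed subset of a connected locally compact Hausdorff space such that, locally,
`B` is connected and nowhere dense and does not disconnect. If the complement of `B` is metrisable,
then `B` has at most countably many compact components. -/
theorem countable_compact_components_of_locally {M : Type*} [TopologicalSpace M] [T2Space M]
    [ConnectedSpace M] [LocallyCompactSpace M] {B : Set M} (hB : IsClosed B)
    (hint : TopologicalSpace.MetrizableSpace ↥(Bᶜ))
    (h : ∀ x : M, ∀ V ∈ 𝓝 x, ∃ U ⊆ V, IsOpen U ∧ x ∈ U ∧ IsPreconnected (U ∩ B) ∧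
      IsPreconnected (U \ B) ∧ U ⊆ closure (U \ B)) :
    {C : Set ↥B | (∃ x, C = connectedComponent x) ∧ IsCompact C}.Countable := by
  have h' : ∀ x : M, ∀ V ∈ 𝓝 x, ∃ U ⊆ V, IsOpen U ∧ x ∈ U ∧ IsPreconnected (U \ B) ∧
      U ⊆ closure (U \ B) := fun x V hV =>
    let ⟨U, h₁, h₂, h₃, _, h₅⟩ := h x V hV
    ⟨U, h₁, h₂, h₃, h₅⟩
  have : LocallyConnectedSpace M := locallyConnectedSpace_iff_connected_subsets.2 fun x V hV =>
    let ⟨U, hUV, hUo, hxU, hUp, hUc⟩ := h' x V hV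
    ⟨U, hUo.mem_nhds hxU, hUp.subset_closure sdiff_subset hUc, hUV⟩
  have : LocallyConnectedSpace B := locallyConnectedSpace_iff_connected_subsets.2 fun x V hV => by
    obtain ⟨V', hV', hVV'⟩ := mem_nhds_subtype B x V |>.1 hV
    obtain ⟨U, hUV, hUo, hxU, hUp, -⟩ := h x V' hV'
    refine ⟨(↑) ⁻¹' U, (hUo.preimage continuous_subtype_val).mem_nhds hxU, ?_,
      (preimage_mono hUV).trans hVV'⟩
    rw [← IsInducing.subtypeVal.isPreconnected_image, Subtype.image_preimage_coe, inter_comm]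
    exact hUp
  have hIo : IsOpen Bᶜ := hB.isOpen_compl
  have : PreconnectedSpace ↥(Bᶜ) := isPreconnected_iff_preconnectedSpace.1 <| by
    rw [compl_eq_univ_sdiff]
    exact isPreconnected_univ.diff_of_locally h' hB isOpen_univ
  have : LocallyCompactSpace ↥(Bᶜ) := hIo.locallyCompactSpace
  let : MetricSpace ↥(Bᶜ) := TopologicalSpace.metrizableSpaceMetric _
  have : SigmaCompactSpace ↥(Bᶜ) := sigmaCompactSpace_of_paracompact_of_preconnected
  have : SecondCountableTopology ↥(Bᶜ) := EMetric.secondCountable_of_sigmaCompact _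
  let Q := (TopologicalSpace.exists_countable_dense ↥(Bᶜ)).choose
  have hQ : Q.Countable ∧ Dense Q := (TopologicalSpace.exists_countable_dense ↥(Bᶜ)).choose_spec
  let K : ℕ → Set M := fun k => (↑) '' CompactExhaustion.choice ↥(Bᶜ) k
  have hKc : ∀ k, IsCompact (K k) := fun k =>
    ((CompactExhaustion.choice ↥(Bᶜ)).isCompact k).image continuous_subtype_val
  have hKB : ∀ k, Disjoint (K k) B := fun k => by
    rw [disjoint_left]
    rintro _ ⟨y, -, rfl⟩
    exact y.2
  let F : ℕ × ↥(Bᶜ) → Set B := fun p => (↑) ⁻¹' closure (connectedComponentIn (Bᶜ \ K p.1) p.2)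
  refine (((countable_univ (α := ℕ)).prod hQ.1).image F).mono ?_
  rintro C ⟨⟨c, rfl⟩, hC⟩
  set C' : Set M := (↑) '' connectedComponent c with hC'
  have hcC' : (c : M) ∈ C' := mem_image_of_mem _ mem_connectedComponent
  have hC'c : IsCompact C' := hC.image continuous_subtype_val
  have hC'p : IsPreconnected C' :=
    isPreconnected_connectedComponent.image _ continuous_subtype_val.continuousOn
  have hC'B : C' ⊆ B := by rintro _ ⟨y, -, rfl⟩; exact y.2
  obtain ⟨V, hVo, hV⟩ := isOpen_induced_iff.1 (isOpen_connectedComponent (x := c))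
  have hVB : B ∩ V = C' := by rw [hC', ← hV, Subtype.image_preimage_coe]
  obtain ⟨L, hLc, hCL, hLV⟩ := exists_compact_between hC'c hVo (hVB ▸ inter_subset_right)
  have hLB : L ∩ B ⊆ C' := fun y hy => hVB ▸ ⟨hy.2, hLV hy.1⟩
  have hfrB : L \ interior L ⊆ Bᶜ := fun y hy hyB => hy.2 (hCL (hLB ⟨hy.1, hyB⟩))
  have hfr : IsCompact ((↑) ⁻¹' (L \ interior L) : Set ↥(Bᶜ)) := by
    rw [Subtype.isCompact_iff, Subtype.image_preimage_coe, inter_eq_right.2 hfrB]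
    exact hLc.diff isOpen_interior
  obtain ⟨k, hk⟩ := (CompactExhaustion.choice ↥(Bᶜ)).exists_superset_of_isCompact hfr
  have hfrK : L \ interior L ⊆ K k := fun y hy => ⟨⟨y, hfrB hy⟩, hk hy, rfl⟩
  have hGo : IsOpen (interior L \ K k) := isOpen_interior.sdiff (hKc k).isClosed
  have hC'G : C' ⊆ interior L \ K k := fun y hy =>
    ⟨hCL hy, fun hyK => disjoint_left.1 (hKB k) hyK (hC'B hy)⟩
  set W := connectedComponentIn (interior L \ K k) (c : M)
  have hWo : IsOpen W := hGo.connectedComponentIn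
  have hWG : W ⊆ interior L \ K k := connectedComponentIn_subset _ _
  have hC'W : C' ⊆ W := hC'p.subset_connectedComponentIn hcC' hC'G
  have hWcl : W ⊆ closure (W \ B) := fun x hx =>
    let ⟨U, hUW, _, hxU, _, hUc⟩ := h' x W (hWo.mem_nhds hx)
    closure_mono (sdiff_subset_sdiff_left hUW) (hUc hxU)
  have hWBp : IsPreconnected (W \ B) :=
    isPreconnected_connectedComponentIn.diff_of_locally h' hB hWo
  have hWBo : IsOpen (W \ B) := hWo.sdiff hB
  have hWBne : (W \ B).Nonempty := closure_nonempty_iff.1 ⟨c, hWcl (hC'W hcC')⟩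
  obtain ⟨q, hqW, hqQ⟩ := hQ.2.inter_open_nonempty ((↑) ⁻¹' (W \ B))
    (hWBo.preimage continuous_subtype_val) (by
      obtain ⟨y, hy⟩ := hWBne
      exact ⟨⟨y, hy.2⟩, hy⟩)
  refine ⟨(k, q), ⟨mem_univ _, hqQ⟩, ?_⟩
  set E := connectedComponentIn (Bᶜ \ K k) (q : M)
  have hWE : W \ B ⊆ E := hWBp.subset_connectedComponentIn hqW fun y hy => ⟨hy.2, (hWG hy.1).2⟩
  have hEL : E ⊆ interior L := by
    refine isPreconnected_connectedComponentIn.subset_left_of_subset_union isOpen_interior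
      hLc.isClosed.isOpen_compl (disjoint_compl_right.mono_left interior_subset) ?_
      ⟨q, hWE hqW, (hWG hqW.1).1⟩
    intro y hy
    by_contra hn
    rw [mem_union, not_or, notMem_compl_iff] at hn
    exact (connectedComponentIn_subset _ _ hy).2 (hfrK ⟨hn.2, hn.1⟩)
  ext y
  constructor
  · intro hy
    have hyL : (y : M) ∈ L := hLc.isClosed.closure_subset_iff.2 (hEL.trans interior_subset) hy
    obtain ⟨z, hz, hzy⟩ := hLB ⟨hyL, y.2⟩
    rwa [← Subtype.ext hzy]
  · intro hy
    exact closure_mono hWE (hWcl (hC'W (mem_image_of_mem _ hy)))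

/-- A neighbourhood of `x` homeomorphic to `Y` gives an open partial homeomorphism to `Y` defined
at `x`. -/
theorem exists_openPartialHomeomorph_of_mem_nhds {Y : Type*} [TopologicalSpace Y] {x : X}
    {U : Set X} (hU : U ∈ 𝓝 x) (φ : U ≃ₜ Y) : ∃ e : OpenPartialHomeomorph X Y, x ∈ e.source := by
  have hx : x ∈ interior U := mem_interior_iff_mem_nhds.2 hU
  have : Nonempty (interior U) := ⟨⟨x, hx⟩⟩
  have hi : IsOpenEmbedding (inclusion (interior_subset (s := U))) :=
    .inclusion _ (isOpen_interior.preimage continuous_subtype_val)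
  have hj := φ.isOpenEmbedding.comp hi
  refine ⟨(isOpen_interior.isOpenEmbedding_subtypeVal.toOpenPartialHomeomorph _).symm.trans
    (hj.toOpenPartialHomeomorph _), ?_⟩
  simpa using hx

theorem hasInteriorChart_iff {n : ℕ} {x : X} :
    HasInteriorChart n x ↔ ∃ e : OpenPartialHomeomorph X (Fin n → ℝ), x ∈ e.source := by
  constructor
  · rintro ⟨U, hU, ⟨φ⟩⟩
    exact exists_openPartialHomeomorph_of_mem_nhds hU φ
  · rintro ⟨e, hx⟩
    obtain ⟨r, hr, hrt⟩ := Metric.isOpen_iff.1 e.open_target (e x) (e.map_source hx)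
    let f := (OpenPartialHomeomorph.univBall (e x) r).trans e.symm
    have hf : f.source = univ := by
      refine eq_univ_of_forall fun y => ?_
      have : OpenPartialHomeomorph.univBall (e x) r y ∈ Metric.ball (e x) r := by
        rw [← OpenPartialHomeomorph.univBall_target (e x) hr]
        exact OpenPartialHomeomorph.map_source _ (by simp)
      simpa [f] using hrt this
    have h0 : f 0 = x := by simp [f, hx]
    refine ⟨f.target, f.open_target.mem_nhds ?_, ⟨f.toHomeomorphSourceTarget.symm.trans
      ((Homeomorph.setCongr hf).trans (Homeomorph.Set.univ _))⟩⟩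
    rw [← h0]
    exact f.map_source (hf ▸ mem_univ _)

theorem OpenPartialHomeomorph.hasInteriorChart_iff {Y : Type*} [TopologicalSpace Y] {n : ℕ}
    (e : OpenPartialHomeomorph X Y) {x : X} (hx : x ∈ e.source) :
    HasInteriorChart n (e x) ↔ HasInteriorChart n x := by
  rw [_root_.hasInteriorChart_iff, _root_.hasInteriorChart_iff]
  constructor
  · rintro ⟨f, hf⟩
    exact ⟨e.trans f, by simp [hx, hf]⟩
  · rintro ⟨f, hf⟩
    exact ⟨e.symm.trans f, by simp [hx, hf]⟩

theorem isClosed_mBoundary (n : ℕ) (M : Type*) [TopologicalSpace M] :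
    IsClosed (mBoundary n M) := by
  rw [← isOpen_compl_iff, isOpen_iff_mem_nhds]
  intro x hx
  obtain ⟨e, he⟩ := hasInteriorChart_iff.1 (not_not.1 hx)
  exact Filter.mem_of_superset (e.open_source.mem_nhds he) fun y hy =>
    not_not.2 (hasInteriorChart_iff.2 ⟨e, hy⟩)

/-- The open partial homeomorphism `[0,∞) → ℝ` which is the inclusion on `(0,∞)`. -/
noncomputable def posOpenPartialHomeomorph : OpenPartialHomeomorph {r : ℝ // 0 ≤ r} ℝ where
  toFun := (↑)
  invFun t := ⟨max t 0, le_max_right _ _⟩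
  source := {r | (0 : ℝ) < r}
  target := Ioi 0
  map_source' _ hr := hr
  map_target' t ht := show (0 : ℝ) < max t 0 from lt_max_of_lt_left ht
  left_inv' r _ := Subtype.ext (max_eq_left r.2)
  right_inv' _ ht := max_eq_left (le_of_lt ht)
  open_source := isOpen_lt continuous_const continuous_subtype_val
  open_target := isOpen_Ioi
  continuousOn_toFun := continuous_subtype_val.continuousOn
  continuousOn_invFun := by fun_prop

theorem hasInteriorChart_halfSpace_of_pos {m : ℕ} {z : (Fin m → ℝ) × {r : ℝ // 0 ≤ r}}
    (hz : (0 : ℝ) < z.2) : HasInteriorChart (m + 1) z := by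
  have e : ((Fin m → ℝ) × ℝ) ≃L[ℝ] (Fin (m + 1) → ℝ) :=
    ContinuousLinearEquiv.ofFinrankEq (by simp)
  refine hasInteriorChart_iff.2 ⟨((OpenPartialHomeomorph.refl _).prod
    posOpenPartialHomeomorph).trans e.toHomeomorph.toOpenPartialHomeomorph, ?_⟩
  simpa [posOpenPartialHomeomorph] using hz

theorem hasInteriorChart_halfSpace_zero {m n : ℕ} {a : Fin m → ℝ}
    (ha : HasInteriorChart n ((a, ⟨0, le_rfl⟩) : (Fin m → ℝ) × {r : ℝ // 0 ≤ r}))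
    (b : Fin m → ℝ) :
    HasInteriorChart n ((b, ⟨0, le_rfl⟩) : (Fin m → ℝ) × {r : ℝ // 0 ≤ r}) := by
  let e := ((Homeomorph.addLeft (b - a)).prodCongr
    (Homeomorph.refl {r : ℝ // 0 ≤ r})).toOpenPartialHomeomorph
  simpa [e] using (e.hasInteriorChart_iff (mem_univ _)).2 ha

/-- Half-balls in the half-space. -/
theorem halfSpace_basis {m : ℕ} (z : (Fin m → ℝ) × {r : ℝ // 0 ≤ r})
    {V : Set ((Fin m → ℝ) × {r : ℝ // 0 ≤ r})} (hV : V ∈ 𝓝 z) :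
    ∃ U ⊆ V, IsOpen U ∧ z ∈ U ∧ IsPreconnected (U ∩ {y | (y.2 : ℝ) = 0}) ∧
      IsPreconnected (U ∩ {y | (0 : ℝ) < y.2}) ∧ U ⊆ closure (U ∩ {y | (0 : ℝ) < y.2}) := by
  let f : (Fin m → ℝ) × {r : ℝ // 0 ≤ r} → (Fin m → ℝ) × ℝ := Prod.map id (↑)
  have hf : IsEmbedding f := IsEmbedding.id.prodMap IsEmbedding.subtypeVal
  have hcvx : ∀ S T : Set ((Fin m → ℝ) × ℝ), Convex ℝ S → Convex ℝ T → (∀ y ∈ T, 0 ≤ y.2) →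
      IsPreconnected (f ⁻¹' S ∩ f ⁻¹' T) := by
    intro S T hS hT hT0
    rw [← preimage_inter, ← hf.isInducing.isPreconnected_image, image_preimage_eq_of_subset]
    · exact (hS.inter hT).isPreconnected
    · exact fun y hy => ⟨(y.1, ⟨y.2, hT0 y hy.2⟩), rfl⟩
  rw [hf.isInducing.nhds_eq_comap, Metric.nhds_basis_ball.comap f |>.mem_iff] at hV
  obtain ⟨ε, hε, hεV⟩ := hV
  have hUo : IsOpen (f ⁻¹' Metric.ball (f z) ε) := Metric.isOpen_ball.preimage hf.continuous
  have hlin : IsLinearMap ℝ (Prod.snd : (Fin m → ℝ) × ℝ → ℝ) := (LinearMap.snd ℝ _ _).isLinear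
  refine ⟨f ⁻¹' Metric.ball (f z) ε, hεV, hUo, Metric.mem_ball_self hε,
    hcvx _ {y | y.2 = 0} (convex_ball _ _) (convex_hyperplane hlin 0) fun y hy => hy.ge,
    hcvx _ {y | 0 < y.2} (convex_ball _ _) (convex_halfSpace_gt hlin 0) fun y hy => le_of_lt hy,
    Dense.open_subset_closure_inter ?_ hUo⟩
  have hd : Dense {r : {r : ℝ // 0 ≤ r} | (0 : ℝ) < r} := by
    rw [IsEmbedding.subtypeVal.isInducing.dense_iff]
    intro r
    have hr : (r : ℝ) ∈ closure (Ioi 0) := by rw [closure_Ioi]; exact r.2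
    have hsub : Ioi (0 : ℝ) ⊆ (↑) '' {r : {r : ℝ // 0 ≤ r} | (0 : ℝ) < r} := fun t ht =>
      ⟨⟨t, le_of_lt ht⟩, ht, rfl⟩
    exact closure_mono hsub hr
  exact hd.preimage isOpenMap_snd

/-- If the points of the hyperplane bounding the half-space have no interior charts, then `∂M` is,
in every chart, exactly the hyperplane; so small half-balls have connected intersections with `∂M`
and with its complement. -/
theorem manifold_basis {m : ℕ} {M : Type*} [TopologicalSpace M]
    (hM : IsManifoldWithBoundary (m + 1) M)
    (hH : ∀ a : Fin m → ℝ, ¬ HasInteriorChart (m + 1)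
      ((a, ⟨0, le_rfl⟩) : (Fin m → ℝ) × {r : ℝ // 0 ≤ r}))
    (x : M) {V : Set M} (hV : V ∈ 𝓝 x) :
    ∃ U ⊆ V, IsOpen U ∧ x ∈ U ∧ IsPreconnected (U ∩ mBoundary (m + 1) M) ∧
      IsPreconnected (U \ mBoundary (m + 1) M) ∧ U ⊆ closure (U \ mBoundary (m + 1) M) := by
  obtain ⟨N, hN, ⟨φ⟩⟩ := hM x
  obtain ⟨e, hx⟩ : ∃ e : OpenPartialHomeomorph M ((Fin m → ℝ) × {r : ℝ // 0 ≤ r}),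
      x ∈ e.source := exists_openPartialHomeomorph_of_mem_nhds hN φ
  have hpos : ∀ y ∈ e.target, e.symm y ∉ mBoundary (m + 1) M ↔ (0 : ℝ) < y.2 := by
    intro y hy
    have hy' : HasInteriorChart (m + 1) (e.symm y) ↔ HasInteriorChart (m + 1) y :=
      e.symm.hasInteriorChart_iff hy
    rw [mBoundary, mem_ofPred_eq, not_not, hy']
    refine ⟨fun h => y.2.2.lt_of_ne fun h0 => hH y.1 ?_, hasInteriorChart_halfSpace_of_pos⟩
    have : y = (y.1, ⟨0, le_rfl⟩) := Prod.ext rfl (Subtype.ext h0.symm)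
    rwa [← this]
  have hzero : ∀ y ∈ e.target, e.symm y ∈ mBoundary (m + 1) M ↔ (y.2 : ℝ) = 0 := by
    intro y hy
    rw [← not_iff_not, hpos y hy, y.2.2.lt_iff_ne', Ne]
  obtain ⟨U, hUV, hUo, hxU, hU0, hUpos, hUc⟩ := halfSpace_basis (e x)
    (Filter.inter_mem (e.open_target.mem_nhds (e.map_source hx))
      (e.symm.continuousAt (e.map_source hx) (by simpa [hx] using hV)))
  have hUt : U ⊆ e.target := hUV.trans inter_subset_left
  have hcont : ContinuousOn e.symm U := e.continuousOn_symm.mono hUt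
  have h0 : e.symm '' U ∩ mBoundary (m + 1) M = e.symm '' (U ∩ {y | (y.2 : ℝ) = 0}) := by
    ext p
    constructor
    · rintro ⟨⟨y, hy, rfl⟩, hp⟩
      exact ⟨y, ⟨hy, (hzero y (hUt hy)).1 hp⟩, rfl⟩
    · rintro ⟨y, ⟨hy, hy0⟩, rfl⟩
      exact ⟨⟨y, hy, rfl⟩, (hzero y (hUt hy)).2 hy0⟩
  have h1 : e.symm '' U \ mBoundary (m + 1) M = e.symm '' (U ∩ {y | (0 : ℝ) < y.2}) := by
    ext p
    constructor
    · rintro ⟨⟨y, hy, rfl⟩, hp⟩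
      exact ⟨y, ⟨hy, (hpos y (hUt hy)).1 hp⟩, rfl⟩
    · rintro ⟨y, ⟨hy, hy0⟩, rfl⟩
      exact ⟨⟨y, hy, rfl⟩, (hpos y (hUt hy)).2 hy0⟩
  refine ⟨e.symm '' U, image_subset_iff.2 (hUV.trans inter_subset_right),
    e.isOpen_image_symm_of_subset_target hUo hUt, ⟨e x, hxU, e.left_inv hx⟩, ?_, ?_, ?_⟩
  · rw [h0]
    exact hU0.image _ (hcont.mono inter_subset_left)
  · rw [h1]
    exact hUpos.image _ (hcont.mono inter_subset_left)
  · rw [h1]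
    rintro _ ⟨y, hy, rfl⟩
    exact ((hcont y hy).mono inter_subset_left).mem_closure_image (hUc hy)

theorem IsManifoldWithBoundary.locallyCompactSpace {n : ℕ} {M : Type*} [TopologicalSpace M]
    [T2Space M] (hM : IsManifoldWithBoundary n M) : LocallyCompactSpace M := by
  have : LocallyCompactSpace {r : ℝ // 0 ≤ r} := isClosed_Ici.locallyCompactSpace
  have : WeaklyLocallyCompactSpace M := ⟨fun x => by
    obtain ⟨N, hN, ⟨φ⟩⟩ := hM x
    obtain ⟨e, hx⟩ := exists_openPartialHomeomorph_of_mem_nhds hN φ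
    obtain ⟨K, hKn, hKt, hKc⟩ :=
      LocallyCompactSpace.local_compact_nhds _ _ (e.open_target.mem_nhds (e.map_source hx))
    refine ⟨e.symm '' K, hKc.image_of_continuousOn (e.continuousOn_symm.mono hKt), ?_⟩
    simpa [hx] using e.symm.image_mem_nhds (e.map_source hx) hKn⟩
  infer_instance

/-- The degenerate case: a point with a `0`-dimensional chart is isolated. -/
theorem countable_components_mBoundary_zero (M : Type*) [TopologicalSpace M] [T2Space M]
    [ConnectedSpace M] :
    {C : Set ↥(mBoundary 0 M) | (∃ x, C = connectedComponent x) ∧ IsCompact C}.Countable := by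
  by_cases hb : mBoundary 0 M = univ
  · have : PreconnectedSpace ↥(mBoundary 0 M) :=
      isPreconnected_iff_preconnectedSpace.1 (hb ▸ isPreconnected_univ)
    refine (countable_singleton univ).mono ?_
    rintro _ ⟨⟨x, rfl⟩, -⟩
    exact PreconnectedSpace.connectedComponent_eq_univ x
  · obtain ⟨x, hx⟩ := (ne_univ_iff_exists_notMem _).1 hb
    obtain ⟨U, hU, ⟨φ⟩⟩ := not_not.1 hx
    have hUs : U ⊆ {x} := fun y hy => congrArg Subtype.val
      (φ.injective (Subsingleton.elim (φ ⟨y, hy⟩) (φ ⟨x, mem_of_mem_nhds hU⟩)))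
    have ho : IsOpen ({x} : Set M) :=
      isOpen_singleton_iff_nhds_eq_pure x |>.2 <| le_antisymm
        (Filter.le_pure_iff.2 (Filter.mem_of_superset hU hUs)) (pure_le_nhds x)
    have huniv : ({x} : Set M) = univ := IsClopen.eq_univ ⟨isClosed_singleton, ho⟩ ⟨x, rfl⟩
    have : Finite M := finite_univ_iff.1 (huniv ▸ finite_singleton x)
    exact to_countable _

/-- A connected `n`-manifold with boundary whose interior `M − ∂M` is metrisable has at most
countably many compact connected components in its boundary. -/
theorem countable_compact_boundary_components (n : ℕ) (M : Type*) [TopologicalSpace M]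
    [T2Space M] [ConnectedSpace M] (hM : IsManifoldWithBoundary n M)
    (hint : TopologicalSpace.MetrizableSpace ↥((mBoundary n M)ᶜ)) :
    {C : Set ↥(mBoundary n M) | (∃ x, C = connectedComponent x) ∧ IsCompact C}.Countable := by
  match n with
  | 0 => exact countable_components_mBoundary_zero M
  | m + 1 =>
    by_cases hH : ∃ a : Fin m → ℝ, HasInteriorChart (m + 1)
        ((a, ⟨0, le_rfl⟩) : (Fin m → ℝ) × {r : ℝ // 0 ≤ r})
    · obtain ⟨a, ha⟩ := hH
      have hall : ∀ z : (Fin m → ℝ) × {r : ℝ // 0 ≤ r}, HasInteriorChart (m + 1) z := by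
        rintro ⟨b, r, hr⟩
        rcases hr.eq_or_lt with rfl | hr'
        · exact hasInteriorChart_halfSpace_zero ha b
        · exact hasInteriorChart_halfSpace_of_pos hr'
      have : IsEmpty ↥(mBoundary (m + 1) M) := ⟨fun ⟨x, hx⟩ => hx <| by
        obtain ⟨N, hN, ⟨φ⟩⟩ := hM x
        obtain ⟨e, he⟩ := exists_openPartialHomeomorph_of_mem_nhds hN φ
        exact (e.hasInteriorChart_iff he).1 (hall _)⟩
      exact to_countable _
    · have := hM.locallyCompactSpace
      exact countable_compact_components_of_locally (isClosed_mBoundary _ _) hint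
        fun x V hV => manifold_basis hM (not_exists.1 hH) x hV
end

section
/- Let M be a Hausdorff topological space and B a closed subset of M which is locally collared in M and strongly paracompact in M. Then B is collared in M. -/
open Set Topology unitInterval

variable {X : Type*} [TopologicalSpace X]

/-- `h : cl(U) × [0,1] → X` (with `U ⊆ B` and the closure taken in `B`) is a local collar
of `B` in `X`: an embedding with `h(x,0) = x`, `h⁻¹(B) = cl(U) × {0}`, and `h(U × [0,1))`
open in `X`. -/
def IsLocalCollarMap (B : Set X) (U : Set B) (h : closure U × I → X) : Prop :=
  Topology.IsEmbedding h ∧ (∀ x : closure U, h (x, 0) = ((x : B) : X)) ∧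
    h ⁻¹' B = {p : closure U × I | p.2 = 0} ∧
    IsOpen (h '' {p : closure U × I | (p.1 : B) ∈ U ∧ p.2 < 1})

/-- `B` is locally collared in `X`: there is a cover of `B` by sets open in `B`, each of
which admits a local collar. -/
def IsLocallyCollared (B : Set X) : Prop :=
  ∃ 𝒰 : Set (Set B), (∀ U ∈ 𝒰, IsOpen U) ∧ ⋃₀ 𝒰 = univ ∧
    ∀ U ∈ 𝒰, ∃ h : closure U × I → X, IsLocalCollarMap B U h

/-- `B` is strongly paracompact in `X`: every family of open subsets of `X` covering `B`
admits a refinement by open subsets of `X` still covering `B` in which every member meets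
only finitely many other members. -/
def StronglyParacompactIn (B : Set X) : Prop :=
  ∀ 𝒰 : Set (Set X), (∀ U ∈ 𝒰, IsOpen U) → B ⊆ ⋃₀ 𝒰 →
    ∃ 𝒱 : Set (Set X), (∀ V ∈ 𝒱, IsOpen V) ∧ B ⊆ ⋃₀ 𝒱 ∧
      (∀ V ∈ 𝒱, ∃ U ∈ 𝒰, V ⊆ U) ∧
      ∀ V ∈ 𝒱, {W ∈ 𝒱 | W ≠ V ∧ (W ∩ V).Nonempty}.Finite

open Filter
open scoped NNReal

/-- A local collar of `B` near some of its points, as an open partial homeomorphism. -/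
def IsCollarChart (B : Set X) (Φ : OpenPartialHomeomorph (B × ℝ≥0) X) : Prop :=
  ∀ p ∈ Φ.source, (p.2 = 0 → Φ p = p.1) ∧ (Φ p ∈ B → p.2 = 0)

/-- Near `(b, 0)`, the map `e` coincides with a collar chart. -/
def IsCollarGermAt (B : Set X) (e : B × ℝ≥0 → X) (b : B) : Prop :=
  ∃ Φ, IsCollarChart B Φ ∧ (b, 0) ∈ Φ.source ∧ e =ᶠ[𝓝 (b, 0)] Φ

theorem IsCollarGermAt.congr {B : Set X} {e e' : B × ℝ≥0 → X} {b : B}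
    (h : IsCollarGermAt B e b) (he : e' =ᶠ[𝓝 (b, 0)] e) : IsCollarGermAt B e' b := by
  obtain ⟨Φ, hΦ, hb, h⟩ := h
  exact ⟨Φ, hΦ, hb, he.trans h⟩

theorem continuous_mk_zero {Y : Type*} [TopologicalSpace Y] :
    Continuous fun y : Y => (y, (0 : ℝ≥0)) := by fun_prop

theorem isOpen_setOf_isCollarGermAt (B : Set X) (e : B × ℝ≥0 → X) :
    IsOpen {b | IsCollarGermAt B e b} := by
  rw [isOpen_iff_mem_nhds]
  rintro b ⟨Φ, hΦ, hb, h⟩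
  have h1 : ∀ᶠ x in 𝓝 b, (x, (0 : ℝ≥0)) ∈ Φ.source :=
    continuous_mk_zero.continuousAt.eventually (Φ.open_source.mem_nhds hb)
  have h2 : ∀ᶠ x in 𝓝 b, e =ᶠ[𝓝 (x, 0)] Φ :=
    continuous_mk_zero.continuousAt.eventually h.eventually_nhds
  filter_upwards [h1, h2] with x h1 h2 using ⟨Φ, hΦ, h1, h2⟩

theorem IsLocalCollarMap.exists_chart {B : Set X} {U : Set B} {h : closure U × I → X}
    (hU : IsOpen U) (hh : IsLocalCollarMap B U h) {b : B} (hb : b ∈ U) :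
    ∃ Φ, IsCollarChart B Φ ∧ (b, 0) ∈ Φ.source := by
  obtain ⟨hemb, h0, hpre, hopen⟩ := hh
  let S : Set (B × ℝ≥0) := {p | p.1 ∈ U ∧ p.2 < 1}
  have hS : IsOpen S :=
    (hU.preimage continuous_fst).inter (isOpen_Iio.preimage continuous_snd)
  let j : S → closure U × I := fun p =>
    (⟨p.1.1, subset_closure p.2.1⟩, ⟨p.1.2, p.1.2.2, NNReal.coe_le_one.2 p.2.2.le⟩)
  have hj : IsEmbedding j := by
    let k : closure U × I → B × ℝ≥0 := fun q => (q.1, ⟨q.2, q.2.2.1⟩)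
    have hjc : Continuous j := by fun_prop
    have hkc : Continuous k := by fun_prop
    exact .of_comp hjc hkc (IsEmbedding.subtypeVal (p := S))
  have hrange : range (h ∘ j) = h '' {p : closure U × I | (p.1 : B) ∈ U ∧ p.2 < 1} := by
    rw [range_comp]
    congr 1
    ext q
    constructor
    · rintro ⟨p, rfl⟩
      exact ⟨p.2.1, p.2.2⟩
    · rintro ⟨h1, h2⟩
      exact ⟨⟨(q.1, ⟨q.2, q.2.2.1⟩), h1, h2⟩, rfl⟩
  have hhj : IsOpenEmbedding (h ∘ j) := ⟨hemb.comp hj, hrange ▸ hopen⟩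
  have hv : IsOpenEmbedding (Subtype.val : S → B × ℝ≥0) := hS.isOpenEmbedding_subtypeVal
  have hbS : ((b, 0) : B × ℝ≥0) ∈ S := ⟨hb, zero_lt_one⟩
  have : Nonempty S := ⟨⟨_, hbS⟩⟩
  let Φ := (hv.toOpenPartialHomeomorph _).symm.trans (hhj.toOpenPartialHomeomorph _)
  have hsrc : Φ.source = S := by simp [Φ]
  have hval : ∀ p : S, Φ p = h (j p) := fun p => by
    change (h ∘ j) ((hv.toOpenPartialHomeomorph _).symm p) = _
    rw [hv.toOpenPartialHomeomorph_left_inv]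
    rfl
  refine ⟨Φ, fun p hp => ?_, hsrc ▸ hbS⟩
  rw [hsrc] at hp
  rw [hval ⟨p, hp⟩]
  constructor
  · intro hp0
    rw [← h0 ⟨p.1, subset_closure hp.1⟩]
    congr 1
    refine Prod.ext rfl (Subtype.ext ?_)
    simp [j, hp0]
  · intro hB
    have : j ⟨p, hp⟩ ∈ h ⁻¹' B := hB
    rw [hpre] at this
    have := congrArg Subtype.val this
    exact NNReal.coe_eq_zero.1 this

/-- Conjugate `φ` by the translation `(y, s) ↦ (y, s - τ y)`, where `φ` is extended by the
identity to negative heights. -/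
noncomputable def shiftConj {Y : Type*} (τ : Y → ℝ≥0) (φ : Y × ℝ≥0 → Y × ℝ≥0)
    (p : Y × ℝ≥0) : Y × ℝ≥0 :=
  if p.2 < τ p.1 then p
  else ((φ (p.1, p.2 - τ p.1)).1, (φ (p.1, p.2 - τ p.1)).2 + τ (φ (p.1, p.2 - τ p.1)).1)

theorem shiftConj_of_lt {Y : Type*} {τ : Y → ℝ≥0} {φ : Y × ℝ≥0 → Y × ℝ≥0} {p : Y × ℝ≥0}
    (h : p.2 < τ p.1) :
    shiftConj τ φ p = p := if_pos h

theorem shiftConj_of_le {Y : Type*} {τ : Y → ℝ≥0} {φ : Y × ℝ≥0 → Y × ℝ≥0} {p : Y × ℝ≥0}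
    (h : τ p.1 ≤ p.2) :
    shiftConj τ φ p =
      ((φ (p.1, p.2 - τ p.1)).1, (φ (p.1, p.2 - τ p.1)).2 + τ (φ (p.1, p.2 - τ p.1)).1) :=
  if_neg h.not_gt

section ShiftConj

variable {Y : Type*} [TopologicalSpace Y] {τ : Y → ℝ≥0}

theorem shiftConj_mem (φ : OpenPartialHomeomorph (Y × ℝ≥0) (Y × ℝ≥0))
    (h0 : ∀ p ∈ φ.source, p.2 = 0 → φ p = p) {p : Y × ℝ≥0}
    (hp : (p.1, p.2 - τ p.1) ∈ φ.source) :
    ((shiftConj τ φ p).1, (shiftConj τ φ p).2 - τ (shiftConj τ φ p).1) ∈ φ.target := by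
  rcases lt_or_ge p.2 (τ p.1) with h | h
  · rw [shiftConj_of_lt h]
    have h2 : p.2 - τ p.1 = 0 := tsub_eq_zero_of_le h.le
    rw [← h0 _ hp h2]
    exact φ.map_source hp
  · rw [shiftConj_of_le h]
    simpa using φ.map_source hp

theorem shiftConj_leftInverse (φ : OpenPartialHomeomorph (Y × ℝ≥0) (Y × ℝ≥0)) {p : Y × ℝ≥0}
    (hp : (p.1, p.2 - τ p.1) ∈ φ.source) :
    shiftConj τ φ.symm (shiftConj τ φ p) = p := by
  rcases lt_or_ge p.2 (τ p.1) with h | h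
  · rw [shiftConj_of_lt h, shiftConj_of_lt h]
  · rw [shiftConj_of_le h, shiftConj_of_le (by simp)]
    simp only [add_tsub_cancel_right, Prod.mk.eta, φ.left_inv hp]
    exact Prod.ext rfl (tsub_add_cancel_of_le h)

theorem continuousOn_shiftConj (hτ : Continuous τ)
    (φ : OpenPartialHomeomorph (Y × ℝ≥0) (Y × ℝ≥0))
    (h0 : ∀ p ∈ φ.source, p.2 = 0 → φ p = p) :
    ContinuousOn (shiftConj τ φ) {p | (p.1, p.2 - τ p.1) ∈ φ.source} := by
  have hc : ContinuousOn (fun p : Y × ℝ≥0 => φ (p.1, p.2 - τ p.1))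
      {p | (p.1, p.2 - τ p.1) ∈ φ.source} :=
    φ.continuousOn.comp (by fun_prop) fun p hp => hp
  refine ContinuousOn.if ?_ continuousOn_id (ContinuousOn.mono ?_ inter_subset_left)
  · rintro p ⟨hp, hfr⟩
    have h1 : p.2 = τ p.1 :=
      frontier_lt_subset_eq continuous_snd (hτ.comp continuous_fst) hfr
    have h2 : p.2 - τ p.1 = 0 := by simp [h1]
    rw [h0 _ hp h2]
    exact Prod.ext rfl (by simp [h1])
  · exact hc.fst.prodMk (hc.snd.add (hτ.comp_continuousOn hc.fst))

/-- `shiftConj` as an open partial homeomorphism. -/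
noncomputable def shiftConjHomeomorph (hτ : Continuous τ)
    (φ : OpenPartialHomeomorph (Y × ℝ≥0) (Y × ℝ≥0))
    (h0 : ∀ p ∈ φ.source, p.2 = 0 → φ p = p) (h0' : ∀ p ∈ φ.target, p.2 = 0 → φ.symm p = p) :
    OpenPartialHomeomorph (Y × ℝ≥0) (Y × ℝ≥0) where
  toFun := shiftConj τ φ
  invFun := shiftConj τ φ.symm
  source := {p | (p.1, p.2 - τ p.1) ∈ φ.source}
  target := {p | (p.1, p.2 - τ p.1) ∈ φ.target}
  map_source' _ hp := shiftConj_mem φ h0 hp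
  map_target' _ hp := shiftConj_mem φ.symm h0' hp
  left_inv' _ hp := shiftConj_leftInverse φ hp
  right_inv' _ hp := shiftConj_leftInverse φ.symm hp
  open_source := φ.open_source.preimage (by fun_prop)
  open_target := φ.open_target.preimage (by fun_prop)
  continuousOn_toFun := continuousOn_shiftConj hτ φ h0
  continuousOn_invFun := continuousOn_shiftConj hτ φ.symm h0'

end ShiftConj

theorem IsCollarChart.transition {B : Set X} {Φ Ψ : OpenPartialHomeomorph (B × ℝ≥0) X}
    (hΦ : IsCollarChart B Φ) (hΨ : IsCollarChart B Ψ) {p : B × ℝ≥0}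
    (hp : p ∈ (Ψ.trans Φ.symm).source) :
    (p.2 = 0 → Φ.symm (Ψ p) = p) ∧ ((Φ.symm (Ψ p)).2 = 0 → p.2 = 0) := by
  obtain ⟨h1, h2⟩ : p ∈ Ψ.source ∧ Ψ p ∈ Φ.target := by simpa using hp
  have h3 := Φ.map_target h2
  have h4 := Φ.right_inv h2
  constructor
  · intro h0
    have h5 := (hΨ p h1).1 h0
    have h6 : (Φ.symm (Ψ p)).2 = 0 := (hΦ _ h3).2 (by rw [h4, h5]; exact p.1.2)
    have h7 := h5.symm.trans (h4.symm.trans ((hΦ _ h3).1 h6))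
    exact Prod.ext (Subtype.ext h7.symm) (h6.trans h0.symm)
  · intro h0
    have h7 := (hΦ _ h3).1 h0
    rw [h4] at h7
    exact (hΨ p h1).2 (by rw [h7]; exact Subtype.prop _)

/-- The chart that follows `Φ` up to height `τ` and then `Ψ`. -/
theorem IsCollarChart.mix {B : Set X} {Φ Ψ : OpenPartialHomeomorph (B × ℝ≥0) X}
    (hΦ : IsCollarChart B Φ) (hΨ : IsCollarChart B Ψ) {τ : B → ℝ≥0} (hτ : Continuous τ) {b : B}
    (hbΦ : (b, 0) ∈ Φ.source) (hbΨ : (b, 0) ∈ Ψ.source) (hb : τ b = 0) :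
    IsCollarGermAt B (Φ ∘ shiftConj τ (Φ.symm ∘ Ψ)) b := by
  set φ := Ψ.trans Φ.symm with hφ
  have h0 : ∀ p ∈ φ.source, p.2 = 0 → φ p = p := fun p hp => (hΦ.transition hΨ hp).1
  have h0' : ∀ p ∈ φ.target, p.2 = 0 → φ.symm p = p := fun p hp h => by
    have h1 := φ.map_target hp
    have h2 := φ.right_inv hp
    have h3 : (φ.symm p).2 = 0 := (hΦ.transition hΨ h1).2 (by rw [← h] ; exact congrArg _ h2)
    rw [← h0 _ h1 h3, h2]
  let G := shiftConjHomeomorph hτ φ h0 h0'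
  have hG : ⇑G = shiftConj τ (Φ.symm ∘ Ψ) := rfl
  have hbφ : ((b, 0) : B × ℝ≥0) ∈ φ.source := by
    have : Ψ (b, 0) = Φ (b, 0) := by rw [(hΨ _ hbΨ).1 rfl, (hΦ _ hbΦ).1 rfl]
    simp [hφ, hbΨ, this, Φ.map_source hbΦ]
  have hGs : ∀ p, p ∈ G.source ↔ (p.1, p.2 - τ p.1) ∈ φ.source := fun p => Iff.rfl
  have hGlow : ∀ p ∈ G.source, p.2 ≤ τ p.1 → G p = p := fun p hp h => by
    rcases h.lt_or_eq with h | h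
    · exact shiftConj_of_lt h
    · have h3 : p.2 - τ p.1 = 0 := by simp [h]
      have h2 : (Φ.symm ∘ Ψ) (p.1, p.2 - τ p.1) = (p.1, p.2 - τ p.1) := h0 _ hp h3
      rw [hG, shiftConj_of_le h.ge, h2]
      exact Prod.ext rfl (by simp [h])
  have hGzero : ∀ p ∈ G.source, (G p).2 = 0 → p.2 = 0 := fun p hp h => by
    rcases le_or_gt p.2 (τ p.1) with h1 | h1
    · rwa [hGlow p hp h1] at h
    · rw [hG, shiftConj_of_le h1.le] at h
      have h2 := (hΦ.transition hΨ hp).2 (add_eq_zero.1 h).1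
      exact absurd h1 (tsub_eq_zero_iff_le.1 h2).not_gt
  refine ⟨G.trans Φ, fun p hp => ?_, ?_, EventuallyEq.rfl⟩
  · obtain ⟨h1, h2⟩ : p ∈ G.source ∧ G p ∈ Φ.source := by simpa using hp
    refine ⟨fun h => ?_, fun h => hGzero p h1 ((hΦ _ h2).2 h)⟩
    have h3 := hGlow p h1 (h ▸ zero_le)
    rw [h3] at h2
    change Φ (G p) = p.1
    rw [h3]
    exact (hΦ p h2).1 h
  · have h1 : ((b, 0) : B × ℝ≥0) ∈ G.source := by rw [hGs]; simpa [hb] using hbφ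
    simp [h1, hGlow _ h1 (zero_le), hbΦ]

/-- Milnor's trick: a paracompact space has a countable open cover each of whose members carries a
locally constant choice among the members of a given open cover. -/
theorem exists_countable_cover_locally_const {Y : Type*} [TopologicalSpace Y] [T2Space Y]
    [ParacompactSpace Y] {ι : Type*} (N : ι → Set Y) (hN : ∀ i, IsOpen (N i))
    (hcov : ⋃ i, N i = univ) :
    ∃ (V : ℕ → Set Y) (κ : ℕ → Y → ι), (∀ n, IsOpen (V n)) ∧ ⋃ n, V n = univ ∧
      ∀ n, ∀ y ∈ V n, y ∈ N (κ n y) ∧ ∀ᶠ z in 𝓝 y, κ n z = κ n y := by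
  classical
  rcases isEmpty_or_nonempty Y with hY | ⟨⟨y₀⟩⟩
  · exact ⟨fun _ => ∅, fun _ y => isEmptyElim y, fun _ => isOpen_empty,
      Subsingleton.elim _ _, fun _ y => isEmptyElim y⟩
  have : Nonempty ι := by
    obtain ⟨i, -⟩ := iUnion_eq_univ_iff.1 hcov y₀
    exact ⟨i⟩
  obtain ⟨f, hf⟩ := PartitionOfUnity.exists_isSubordinate isClosed_univ N hN hcov.ge
  let W : Finset ι → Set Y := fun F => {y | ∀ i ∈ F, 0 < f i y ∧ ∀ j ∉ F, f j y < f i y}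
  have hW : ∀ F, IsOpen (W F) := fun F => by
    rw [isOpen_iff_mem_nhds]
    intro y hy
    obtain ⟨t, ht, hfin⟩ := f.locallyFinite y
    have h1 : ∀ᶠ z in 𝓝 y, ∀ i ∈ F, 0 < f i z := by
      rw [Finset.eventually_all]
      exact fun i hi => (f i).continuous.continuousAt.eventually (lt_mem_nhds (hy i hi).1)
    have h2 : ∀ᶠ z in 𝓝 y, ∀ i ∈ F, ∀ j ∈ hfin.toFinset, j ∉ F → f j z < f i z := by
      rw [Finset.eventually_all]
      intro i hi
      rw [Finset.eventually_all]
      intro j _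
      by_cases hj : j ∈ F
      · simp [hj]
      · filter_upwards [(f j).continuous.continuousAt.eventually_lt
          (f i).continuous.continuousAt ((hy i hi).2 j hj)] with z hz _ using hz
    filter_upwards [h1, h2, ht] with z h1 h2 hz i hi
    refine ⟨h1 i hi, fun j hj => ?_⟩
    by_cases hjs : f j z = 0
    · rw [hjs]; exact h1 i hi
    · exact h2 i hi j (hfin.mem_toFinset.2 ⟨z, hjs, hz⟩) hj
  have hdisj : ∀ F G : Finset ι, F.card = G.card → ∀ y, y ∈ W F → y ∈ W G → F = G := by
    intro F G hc y hF hG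
    by_contra hne
    have h1 : ¬ F ⊆ G := fun h => hne (Finset.eq_of_subset_of_card_le h hc.ge)
    have h2 : ¬ G ⊆ F := fun h => hne (Finset.eq_of_subset_of_card_le h hc.le).symm
    obtain ⟨i, hiF, hiG⟩ := Finset.not_subset.1 h1
    obtain ⟨j, hjG, hjF⟩ := Finset.not_subset.1 h2
    exact lt_asymm ((hF i hiF).2 j hjF) ((hG j hjG).2 i hiG)
  let P : ℕ → Y → Finset ι → Prop := fun n y F => F.card = n + 1 ∧ y ∈ W F
  let g : Finset ι → ι := fun F => if h : F.Nonempty then h.choose else Classical.arbitrary ι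
  have hg : ∀ F : Finset ι, F.Nonempty → g F ∈ F := fun F h => by
    simp only [g, dif_pos h]
    exact h.choose_spec
  let κ : ℕ → Y → ι := fun n y => if h : ∃ F, P n y F then g h.choose else Classical.arbitrary ι
  have hκ : ∀ n y F, P n y F → κ n y = g F := fun n y F h => by
    have hex : ∃ F, P n y F := ⟨F, h⟩
    simp only [κ, dif_pos hex]
    rw [hdisj _ F (hex.choose_spec.1.trans h.1.symm) y hex.choose_spec.2 h.2]
  refine ⟨fun n => ⋃ F ∈ {F : Finset ι | F.card = n + 1}, W F, κ,
    fun n => isOpen_biUnion fun F _ => hW F, ?_, ?_⟩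
  · refine iUnion_eq_univ_iff.2 fun y => ?_
    have hfin : (Function.support fun i => f i y).Finite := f.locallyFinite.point_finite y
    have hmem : ∀ i, i ∈ hfin.toFinset ↔ f i y ≠ 0 := fun i => by simp
    obtain ⟨i, hi⟩ := f.exists_pos (mem_univ y)
    have hne : hfin.toFinset.card ≠ 0 := Finset.card_ne_zero_of_mem ((hmem i).2 hi.ne')
    refine ⟨hfin.toFinset.card - 1, mem_biUnion (x := hfin.toFinset) ?_ fun i hi => ?_⟩
    · change _ = _
      omega
    · have hpos : 0 < f i y := (f.nonneg i y).lt_of_ne' ((hmem i).1 hi)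
      refine ⟨hpos, fun j hj => ?_⟩
      rwa [not_not.1 (mt (hmem j).2 hj)]
  · intro n y hy
    obtain ⟨F, hF, hyF⟩ := mem_iUnion₂.1 hy
    have hP : P n y F := ⟨hF, hyF⟩
    refine ⟨?_, ?_⟩
    · rw [hκ n y F hP]
      have hFne : F.Nonempty := Finset.card_pos.1 (by rw [hP.1]; omega)
      exact hf _ (subset_closure (hyF _ (hg F hFne)).1.ne')
    · filter_upwards [(hW F).mem_nhds hyF] with z hz
      rw [hκ n y F hP, hκ n z F ⟨hF, hz⟩]

/-- Extend a collar germ along a closed set `A` over a further closed set `C` on a neighbourhood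
of which collar charts have been chosen in a locally constant way. -/
theorem exists_collarGerm_extension {B : Set X} [NormalSpace B] {e : B × ℝ≥0 → X} {A C V : Set B}
    (hA : IsClosed A) (hC : IsClosed C) (hV : IsOpen V) (hCV : C ⊆ V)
    (he : ∀ b ∈ A, IsCollarGermAt B e b) (k : B → OpenPartialHomeomorph (B × ℝ≥0) X)
    (hk : ∀ b ∈ V, IsCollarChart B (k b) ∧ (b, 0) ∈ (k b).source ∧ ∀ᶠ x in 𝓝 b, k x = k b) :
    ∃ e' : B × ℝ≥0 → X, (∀ b ∈ A ∪ C, IsCollarGermAt B e' b) ∧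
      ∀ b ∈ A, e' =ᶠ[𝓝 (b, 0)] e := by
  classical
  obtain ⟨U, hU, hAU, hUe⟩ := normal_exists_closure_subset hA (isOpen_setOf_isCollarGermAt B e) he
  obtain ⟨V', hV', hCV', hV'V⟩ := normal_exists_closure_subset hC hV hCV
  obtain ⟨f, hf0, hf1, -⟩ := exists_continuous_zero_one_of_isClosed isClosed_closure
    (isOpen_setOf_isCollarGermAt B e).isClosed_compl (disjoint_compl_right_iff_subset.2 hUe)
  let τ : B → ℝ≥0 := fun b => (f b).toNNReal
  have hτ : Continuous τ := continuous_real_toNNReal.comp f.continuous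
  have hτ0 : ∀ b ∈ U, τ b = 0 := fun b hb => by simp [τ, hf0 (subset_closure hb)]
  have hτe : ∀ b, τ b = 0 → IsCollarGermAt B e b := fun b hb => by
    by_contra hne
    have : f b = 1 := hf1 hne
    simp [τ, this] at hb
  let mixed : B → B × ℝ≥0 → X := fun b => k b ∘ shiftConj τ ((k b).symm ∘ e)
  let e' : B × ℝ≥0 → X := fun p => if p.1 ∈ closure V' then mixed p.1 p else e p
  have hfst : ∀ b : B, Tendsto (Prod.fst : B × ℝ≥0 → B) (𝓝 (b, 0)) (𝓝 b) :=
    fun b => continuous_fst.tendsto _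
  have hmixed : ∀ b ∈ V, ∀ᶠ p in 𝓝 ((b, 0) : B × ℝ≥0), mixed p.1 p = mixed b p := fun b hb => by
    filter_upwards [(hfst b).eventually (hk b hb).2.2] with p hp
    simp only [mixed, hp]
  have hagree : ∀ b ∈ A, e' =ᶠ[𝓝 (b, 0)] e := fun b hb => by
    by_cases hbV : b ∈ closure V'
    · have hbV := hV'V hbV
      obtain ⟨hchart, hsrc, -⟩ := hk b hbV
      obtain ⟨Ψ, hΨ, hbΨ, heΨ⟩ := he b hb
      have hbe : e (b, 0) = k b (b, 0) := by
        rw [heΨ.eq_of_nhds, (hΨ _ hbΨ).1 rfl, (hchart _ hsrc).1 rfl]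
      have hec : ContinuousAt e (b, 0) := (Ψ.continuousAt hbΨ).congr heΨ.symm
      have htgt : ∀ᶠ p in 𝓝 ((b, 0) : B × ℝ≥0), e p ∈ (k b).target :=
        hec.eventually ((k b).open_target.mem_nhds (hbe ▸ (k b).map_source hsrc))
      filter_upwards [hmixed b hbV, htgt, (hfst b).eventually (hU.mem_nhds (hAU hb)),
        (hfst b).eventually (hk b hbV).2.2, ((hfst b).eventually (hV.mem_nhds hbV)),
        ((k b).continuousAt_symm ((k b).map_source hsrc) |>.tendsto.comp
          (hbe ▸ hec.tendsto)).eventually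
          (show ∀ᶠ q in 𝓝 ((k b).symm (k b (b, 0))), q.1 ∈ U by
            rw [(k b).left_inv hsrc]
            exact (hfst b).eventually (hU.mem_nhds (hAU hb)))]
        with p h1 h2 h3 h4 h5 h6
      simp only [e']
      split_ifs
      · rw [h1]
        simp only [mixed, Function.comp_apply]
        have h7 : τ ((k b).symm (e p)).1 = 0 := hτ0 _ h6
        rw [shiftConj_of_le (by simp [hτ0 _ h3])]
        simp [hτ0 _ h3, h7, (k b).right_inv h2]
      · rfl
    · filter_upwards [(hfst b).eventually (isClosed_closure.isOpen_compl.mem_nhds hbV)] with p hp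
      exact if_neg hp
  refine ⟨e', fun b hb => ?_, hagree⟩
  rcases hb with hb | hb
  · exact (he b hb).congr (hagree b hb)
  · have hbV := hCV hb
    obtain ⟨hchart, hsrc, -⟩ := hk b hbV
    have h1 : e' =ᶠ[𝓝 (b, 0)] mixed b := by
      filter_upwards [hmixed b hbV, (hfst b).eventually (hV'.mem_nhds (hCV' hb))] with p hp hpV
      simp only [e', if_pos (subset_closure hpV), hp]
    by_cases hb0 : τ b = 0
    · obtain ⟨Ψ, hΨ, hbΨ, heΨ⟩ := hτe b hb0
      refine (hchart.mix hΨ hτ hsrc hbΨ hb0).congr (h1.trans ?_)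
      have hsub : Tendsto (fun p : B × ℝ≥0 => (p.1, p.2 - τ p.1)) (𝓝 (b, 0)) (𝓝 (b, 0)) := by
        have : Continuous fun p : B × ℝ≥0 => (p.1, p.2 - τ p.1) := by fun_prop
        simpa using this.tendsto (b, 0)
      filter_upwards [hsub.eventually heΨ] with p hp
      simp only [mixed, Function.comp_apply, shiftConj, hp]
    · refine ⟨k b, hchart, hsrc, h1.trans ?_⟩
      have hlt : ∀ᶠ p in 𝓝 ((b, 0) : B × ℝ≥0), p.2 < τ p.1 :=
        continuous_snd.continuousAt.eventually_lt (hτ.comp continuous_fst).continuousAt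
          (pos_iff_ne_zero.2 hb0)
      filter_upwards [hlt] with p hp
      simp only [mixed, Function.comp_apply, shiftConj_of_lt hp]

/-- A space with local collar charts at all points of a paracompact subspace `B` has a map
`B × ℝ≥0 → X` which restricts to a collar chart near each point of `B × {0}`. -/
theorem exists_forall_isCollarGermAt {B : Set X} [T2Space B] [ParacompactSpace B]
    (h : ∀ b : B, ∃ Φ, IsCollarChart B Φ ∧ (b, 0) ∈ Φ.source) :
    ∃ e : B × ℝ≥0 → X, ∀ b, IsCollarGermAt B e b := by
  classical
  choose Φ hΦ hsrc using h
  obtain ⟨V, κ, hVo, hVcov, hκ⟩ := exists_countable_cover_locally_const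
    (fun b : B => {x : B | (x, (0 : ℝ≥0)) ∈ (Φ b).source})
    (fun b => (Φ b).open_source.preimage continuous_mk_zero)
    (iUnion_eq_univ_iff.2 fun b => ⟨b, hsrc b⟩)
  obtain ⟨u, huo, hucov, hulf, huV⟩ := precise_refinement V hVo hVcov
  obtain ⟨v, hvcov, hvo, hvu⟩ := exists_iUnion_eq_closure_subset huo hulf.point_finite hucov
  let A : ℕ → Set B := fun n => ⋃ i ∈ Finset.range n, closure (v i)
  have hAc : ∀ n, IsClosed (A n) := fun n =>
    isClosed_biUnion_finset fun i _ => isClosed_closure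
  have hAmono : Monotone A := fun m n hmn =>
    biUnion_subset_biUnion_left fun i hi => by
      simp only [Finset.coe_range, mem_Iio] at hi ⊢
      exact lt_of_lt_of_le hi hmn
  have hAsucc : ∀ n, A (n + 1) = A n ∪ closure (v n) := fun n => by
    simp only [A, Finset.range_add_one, Finset.set_biUnion_insert, union_comm]
  have hstep : ∀ (n : ℕ) (e : {e : B × ℝ≥0 → X // ∀ b ∈ A n, IsCollarGermAt B e b}),
      ∃ e' : {e : B × ℝ≥0 → X // ∀ b ∈ A (n + 1), IsCollarGermAt B e b},
        ∀ b ∈ A n, e'.1 =ᶠ[𝓝 (b, 0)] e.1 := fun n e => by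
    obtain ⟨e', h1, h2⟩ := exists_collarGerm_extension (hAc n) isClosed_closure (hVo n)
      ((hvu n).trans (huV n)) e.2 (fun b => Φ (κ n b)) fun b hb =>
        ⟨hΦ _, (hκ n b hb).1, (hκ n b hb).2.mono fun x hx => congrArg Φ hx⟩
    exact ⟨⟨e', by rwa [hAsucc]⟩, h2⟩
  choose next hnext using hstep
  let E : ∀ n, {e : B × ℝ≥0 → X // ∀ b ∈ A n, IsCollarGermAt B e b} := fun n =>
    Nat.rec ⟨fun p => p.1, fun b hb => by simp [A] at hb⟩ next n
  have hE : ∀ m n, m ≤ n → ∀ b ∈ A m, (E n).1 =ᶠ[𝓝 (b, 0)] (E m).1 := fun m n hmn b hb => by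
    induction n, hmn using Nat.le_induction with
    | base => rfl
    | succ n hmn ih => exact (hnext n (E n) b (hAmono hmn hb)).trans ih
  have hint : ∀ b, ∃ n, b ∈ interior (A n) := fun b => by
    obtain ⟨n, hn⟩ := iUnion_eq_univ_iff.1 hvcov b
    refine ⟨n + 1, interior_maximal ?_ (hvo n) hn⟩
    rw [hAsucc]
    exact subset_closure.trans subset_union_right
  refine ⟨fun p => (E (Nat.find (hint p.1))).1 p, fun b => ?_⟩
  set n := Nat.find (hint b) with hn
  have hbn : b ∈ interior (A n) := Nat.find_spec (hint b)
  refine ((E n).2 b (interior_subset hbn)).congr ?_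
  have hfst : Tendsto (Prod.fst : B × ℝ≥0 → B) (𝓝 (b, 0)) (𝓝 b) := continuous_fst.tendsto _
  have h1 : ∀ᶠ p in 𝓝 ((b, 0) : B × ℝ≥0), ∀ m ∈ Finset.range (n + 1),
      p.1 ∈ A m → (E m).1 p = (E n).1 p := by
    rw [Finset.eventually_all]
    intro m hm
    by_cases hbm : b ∈ A m
    · filter_upwards [hE m n (Nat.lt_succ_iff.1 (Finset.mem_range.1 hm)) b hbm] with p hp _
        using hp.symm
    · filter_upwards [hfst.eventually ((hAc m).isOpen_compl.mem_nhds hbm)] with p hp h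
      exact absurd h hp
  filter_upwards [h1, hfst.eventually (isOpen_interior.mem_nhds hbn)] with p h1 h2
  exact h1 _ (Finset.mem_range.2 (Nat.lt_succ_of_le (Nat.find_min' _ h2)))
    (interior_subset (Nat.find_spec (hint p.1)))

theorem StronglyParacompactIn.exists_locallyFinite_refinement {B : Set X}
    (hB : StronglyParacompactIn B) {𝒰 : Set (Set X)} (ho : ∀ U ∈ 𝒰, IsOpen U) (hc : B ⊆ ⋃₀ 𝒰) :
    ∃ 𝒱 : Set (Set X), (∀ V ∈ 𝒱, IsOpen V) ∧ B ⊆ ⋃₀ 𝒱 ∧ (∀ V ∈ 𝒱, ∃ U ∈ 𝒰, V ⊆ U) ∧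
      ∀ x ∈ B, ∃ N ∈ 𝓝 x, {V ∈ 𝒱 | (V ∩ N).Nonempty}.Finite := by
  obtain ⟨𝒱, h1, h2, h3, h4⟩ := hB 𝒰 ho hc
  refine ⟨𝒱, h1, h2, h3, fun x hx => ?_⟩
  obtain ⟨V, hV, hxV⟩ := h2 hx
  refine ⟨V, (h1 V hV).mem_nhds hxV, ((h4 V hV).insert V).subset fun W hW => ?_⟩
  by_cases hWV : W = V
  · exact Or.inl hWV
  · exact Or.inr ⟨hW.1, hWV, hW.2⟩

theorem StronglyParacompactIn.paracompactSpace {B : Set X} (hB : StronglyParacompactIn B) :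
    ParacompactSpace B := by
  refine ⟨fun α s hs hcov => ?_⟩
  obtain ⟨𝒱, h1, h2, h3, h4⟩ := hB.exists_locallyFinite_refinement
    (𝒰 := {O | IsOpen O ∧ ∃ a, (Subtype.val ⁻¹' O : Set B) ⊆ s a}) (fun U hU => hU.1) (by
      intro x hx
      obtain ⟨a, ha⟩ := iUnion_eq_univ_iff.1 hcov ⟨x, hx⟩
      obtain ⟨O, hO, hOs⟩ := isOpen_induced_iff.1 (hs a)
      exact ⟨O, ⟨hO, a, hOs.subset⟩, by rwa [← hOs] at ha⟩)
  refine ⟨𝒱, fun V => Subtype.val ⁻¹' V.1, fun V => (h1 V V.2).preimage continuous_subtype_val,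
    iUnion_eq_univ_iff.2 fun x => ?_, fun x => ?_, fun V => ?_⟩
  · obtain ⟨V, hV, hx⟩ := h2 x.2
    exact ⟨⟨V, hV⟩, hx⟩
  · obtain ⟨N, hN, hfin⟩ := h4 x x.2
    refine ⟨Subtype.val ⁻¹' N, continuous_subtype_val.continuousAt.preimage_mem_nhds hN,
      (hfin.preimage Subtype.val_injective.injOn).subset ?_⟩
    rintro V ⟨y, hy⟩
    exact ⟨V.2, y, hy⟩
  · obtain ⟨U, ⟨-, a, ha⟩, hVU⟩ := h3 V V.2
    exact ⟨a, (preimage_mono hVU).trans ha⟩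

theorem StronglyParacompactIn.exists_separating_open {B : Set X} (hB : StronglyParacompactIn B)
    {C D : Set X} (hC : IsClosed C) (hD : D ⊆ B)
    (h : ∀ z ∈ C, ∃ O, IsOpen O ∧ z ∈ O ∧ Disjoint (closure O) D) :
    ∃ G, IsOpen G ∧ C ∩ B ⊆ G ∧ Disjoint (closure G) D := by
  obtain ⟨𝒱, h1, h2, h3, h4⟩ := hB.exists_locallyFinite_refinement
    (𝒰 := insert Cᶜ {O | IsOpen O ∧ Disjoint (closure O) D}) (by
      rintro U (rfl | hU)
      exacts [hC.isOpen_compl, hU.1]) (by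
      intro x _
      by_cases hx : x ∈ C
      · obtain ⟨O, hO, hxO, hd⟩ := h x hx
        exact ⟨O, Or.inr ⟨hO, hd⟩, hxO⟩
      · exact ⟨_, Or.inl rfl, hx⟩)
  refine ⟨⋃₀ {V ∈ 𝒱 | (V ∩ C).Nonempty}, isOpen_sUnion fun V hV => h1 V hV.1, ?_, ?_⟩
  · rintro x ⟨hxC, hxB⟩
    obtain ⟨V, hV, hx⟩ := h2 hxB
    exact ⟨V, ⟨hV, x, hx, hxC⟩, hx⟩
  · refine disjoint_right.2 fun y hy hyG => ?_
    obtain ⟨N, hN, hfin⟩ := h4 y (hD hy)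
    have hev : ∀ᶠ x in 𝓝 y, ∀ V ∈ {V ∈ 𝒱 | (V ∩ N).Nonempty}, (V ∩ C).Nonempty → x ∉ V := by
      rw [eventually_all_finite hfin]
      rintro V ⟨hV, -⟩
      by_cases hVC : (V ∩ C).Nonempty
      · obtain ⟨U, hU, hVU⟩ := h3 V hV
        rcases hU with rfl | hU
        · obtain ⟨x, hxV, hxC⟩ := hVC
          exact absurd hxC (hVU hxV)
        · have hyV : y ∉ closure V := fun hyV => disjoint_left.1 hU.2 (closure_mono hVU hyV) hy
          filter_upwards [isClosed_closure.isOpen_compl.mem_nhds hyV] with x hx _ hxV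
          exact hx (subset_closure hxV)
      · exact .of_forall fun x hx => absurd hx hVC
    refine mem_closure_iff_frequently.1 hyG ?_
    filter_upwards [hev, hN] with x hx hxN
    rintro ⟨V, ⟨hV, hVC⟩, hxV⟩
    exact hx V ⟨hV, x, hxV, hxN⟩ hVC hxV

theorem StronglyParacompactIn.exists_open_disjoint_closure [T2Space X] {B : Set X}
    (hB : StronglyParacompactIn B) {C D : Set X} (hC : IsClosed C) (hD : IsClosed D)
    (hCB : C ⊆ B) (hDB : D ⊆ B) (hCD : Disjoint C D) :
    ∃ G, IsOpen G ∧ C ⊆ G ∧ Disjoint (closure G) D := by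
  obtain ⟨G, hG, hCG, hGD⟩ := hB.exists_separating_open hC hDB fun z hz => by
    obtain ⟨G, hG, hDG, hzG⟩ := hB.exists_separating_open hD (singleton_subset_iff.2 (hCB hz))
      fun y hy => by
        obtain ⟨O, O', hO, hO', hyO, hzO', hd⟩ := t2_separation (hCD.ne_of_mem hz hy).symm
        exact ⟨O, hO, hyO, disjoint_singleton_right.2 fun h =>
          disjoint_left.1 (hd.closure_left hO') h hzO'⟩
    refine ⟨(closure G)ᶜ, isClosed_closure.isOpen_compl, disjoint_singleton_right.1 hzG, ?_⟩
    exact (disjoint_compl_left.mono_right subset_closure).closure_left hG |>.mono_right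
      fun y hy => hDG ⟨hy, hDB hy⟩
  exact ⟨G, hG, fun x hx => hCG ⟨hx, hCB hx⟩, hGD⟩

/-- A map which is a collar chart near each point of `B × {0}` is injective on a neighbourhood of
`B × {0}`. -/
theorem StronglyParacompactIn.exists_injOn_of_isCollarGermAt [T2Space X] {B : Set X}
    (hBc : IsClosed B) (hB : StronglyParacompactIn B) {e : B × ℝ≥0 → X}
    (he : ∀ b, IsCollarGermAt B e b) :
    ∃ N : Set (B × ℝ≥0), IsOpen N ∧ (∀ b, (b, 0) ∈ N) ∧ InjOn e N ∧
      ∀ p ∈ N, ∃ Φ, IsCollarChart B Φ ∧ p ∈ Φ.source ∧ e =ᶠ[𝓝 p] Φ := by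
  have := hB.paracompactSpace
  obtain ⟨𝒱, h1, h2, h3, h4⟩ := hB.exists_locallyFinite_refinement
    (𝒰 := {O | IsOpen O ∧ ∃ Φ, IsCollarChart B Φ ∧
      ∀ x : B, (x : X) ∈ O → (x, 0) ∈ Φ.source ∧ e =ᶠ[𝓝 (x, 0)] Φ}) (fun U hU => hU.1) (by
      intro b hb
      obtain ⟨Φ, hΦ, hbΦ, heΦ⟩ := he ⟨b, hb⟩
      obtain ⟨O, hO, hOs⟩ := isOpen_induced_iff.1
        ((Φ.open_source.inter (isOpen_setOfPred_eventually_nhds (p := fun p => e p = Φ p))).preimage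
          (continuous_mk_zero (Y := B)))
      refine ⟨O, ⟨hO, Φ, hΦ, fun x hx => ?_⟩, ?_⟩
      · have : x ∈ Subtype.val ⁻¹' O := hx
        rw [hOs] at this
        exact this
      · have : (⟨b, hb⟩ : B) ∈ Subtype.val ⁻¹' O := by
          rw [hOs]
          exact ⟨hbΦ, heΦ⟩
        exact this)
  have hchart : ∀ V : 𝒱, ∃ Φ, IsCollarChart B Φ ∧
      ∀ x : B, (x : X) ∈ V.1 → (x, 0) ∈ Φ.source ∧ e =ᶠ[𝓝 (x, 0)] Φ := fun V => by
    obtain ⟨U, ⟨-, Φ, hΦ, h⟩, hVU⟩ := h3 V V.2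
    exact ⟨Φ, hΦ, fun x hx => h x (hVU hx)⟩
  choose Φ hΦ hsrc using hchart
  let u : 𝒱 → Set B := fun V => Subtype.val ⁻¹' V.1
  have hufin : ∀ x, {V | x ∈ u V}.Finite := fun x => by
    obtain ⟨N, hN, hfin⟩ := h4 x x.2
    exact (hfin.preimage Subtype.val_injective.injOn).subset fun V hV =>
      ⟨V.2, x, hV, mem_of_mem_nhds hN⟩
  obtain ⟨w, hwcov, hwo, hwu⟩ := exists_iUnion_eq_closure_subset (u := u)
    (fun V : 𝒱 => (h1 V V.2).preimage continuous_subtype_val) hufin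
    (iUnion_eq_univ_iff.2 fun x => by
      obtain ⟨V, hV, hx⟩ := h2 x.2
      exact ⟨⟨V, hV⟩, hx⟩)
  have hwu' : ∀ V, w V ⊆ u V := fun V => subset_closure.trans (hwu V)
  obtain ⟨v, hvcov, hvc, hvw⟩ := exists_iUnion_eq_closed_subset hwo
    (fun x => (hufin x).subset fun V hV => hwu' V hV) hwcov
  have hsep : ∀ V : 𝒱, ∃ G, IsOpen G ∧ Subtype.val '' (v V) ⊆ G ∧
      Disjoint (closure G) (Subtype.val '' (w V)ᶜ) := fun V =>
    hB.exists_open_disjoint_closure (hBc.isClosedEmbedding_subtypeVal.isClosedMap _ (hvc V))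
      (hBc.isClosedEmbedding_subtypeVal.isClosedMap _ (hwo V).isClosed_compl)
      (Subtype.coe_image_subset _ _) (Subtype.coe_image_subset _ _)
      ((disjoint_image_iff Subtype.val_injective).2 (disjoint_compl_right_iff_subset.2 (hvw V)))
  choose G hGo hvG hGw using hsep
  let P : 𝒱 → B × ℝ≥0 → Prop := fun V p => (p.1 ∈ v V → e p ∈ G V ∩ V.1) ∧
    (p.1 ∉ w V → e p ∉ G V ∩ V.1) ∧ (p.1 ∈ closure (w V) → p ∈ (Φ V).source ∧ e p = Φ V p)
  let N : Set (B × ℝ≥0) := interior {p | ∀ V, P V p}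
  have hP : ∀ p ∈ N, ∀ V, P V p := fun p hp => interior_subset hp
  refine ⟨N, isOpen_interior, fun b => ?_, fun p hp q hq hpq => ?_, fun p hp => ?_⟩
  · rw [mem_interior_iff_mem_nhds]
    obtain ⟨Ψ, hΨ, hbΨ, heΨ⟩ := he b
    have heb : e (b, 0) = b := by rw [heΨ.eq_of_nhds, (hΨ _ hbΨ).1 rfl]
    have hec : Tendsto e (𝓝 (b, 0)) (𝓝 (b : X)) :=
      heb ▸ (Ψ.continuousAt hbΨ).congr heΨ.symm
    have hfst : Tendsto (Prod.fst : B × ℝ≥0 → B) (𝓝 (b, 0)) (𝓝 b) := continuous_fst.tendsto _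
    obtain ⟨N₀, hN₀, hfin⟩ := h4 b b.2
    have hev : ∀ᶠ p in 𝓝 ((b, 0) : B × ℝ≥0), ∀ V ∈ {V : 𝒱 | (V.1 ∩ N₀).Nonempty}, P V p := by
      have hfin' : {V : 𝒱 | (V.1 ∩ N₀).Nonempty}.Finite :=
        (hfin.preimage Subtype.val_injective.injOn).subset fun V hV => ⟨V.2, hV⟩
      rw [eventually_all_finite hfin']
      intro V _
      refine .and ?_ (.and ?_ ?_)
      · by_cases hb : b ∈ v V
        · filter_upwards [hec.eventually (((hGo V).inter (h1 V V.2)).mem_nhds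
            ⟨hvG V ⟨b, hb, rfl⟩, hwu' V (hvw V hb)⟩)] with p hp _ using hp
        · filter_upwards [hfst.eventually ((hvc V).isOpen_compl.mem_nhds hb)] with p hp h
          exact absurd h hp
      · by_cases hb : b ∈ w V
        · filter_upwards [hfst.eventually ((hwo V).mem_nhds hb)] with p hp h
          exact absurd hp h
        · have hbG : (b : X) ∉ closure (G V) := fun h => disjoint_left.1 (hGw V) h ⟨b, hb, rfl⟩
          filter_upwards [hec.eventually (isClosed_closure.isOpen_compl.mem_nhds hbG)]
            with p hp _ h
          exact hp (subset_closure h.1)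
      · by_cases hb : b ∈ closure (w V)
        · obtain ⟨h5, h6⟩ := hsrc V b (hwu V hb)
          filter_upwards [(Φ V).open_source.mem_nhds h5, h6] with p h5 h6 _ using ⟨h5, h6⟩
        · filter_upwards [hfst.eventually (isClosed_closure.isOpen_compl.mem_nhds hb)] with p hp h
          exact absurd h hp
    filter_upwards [hev, hec.eventually hN₀,
      (continuous_subtype_val.continuousAt.tendsto.comp hfst).eventually hN₀] with p hp h5 h6 V
    by_cases hV : (V.1 ∩ N₀).Nonempty
    · exact hp V hV
    · have hpV : p.1 ∉ u V := fun h => hV ⟨_, h, h6⟩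
      exact ⟨fun h => absurd (hwu' V (hvw V h)) hpV, fun _ h => hV ⟨_, h.2, h5⟩,
        fun h => absurd (hwu V h) hpV⟩
  · obtain ⟨V, hV⟩ := iUnion_eq_univ_iff.1 hvcov q.1
    have hqG := (hP q hq V).1 hV
    have hpw : p.1 ∈ w V := by
      by_contra h
      exact (hP p hp V).2.1 h (hpq ▸ hqG)
    obtain ⟨h5, h6⟩ := (hP p hp V).2.2 (subset_closure hpw)
    obtain ⟨h7, h8⟩ := (hP q hq V).2.2 (subset_closure (hvw V hV))
    exact (Φ V).injOn h5 h7 (by rw [← h6, ← h8, hpq])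
  · obtain ⟨V, hV⟩ := iUnion_eq_univ_iff.1 hwcov p.1
    refine ⟨Φ V, hΦ V, ((hP p hp V).2.2 (subset_closure hV)).1, ?_⟩
    filter_upwards [isOpen_interior.mem_nhds hp,
      continuous_fst.continuousAt.preimage_mem_nhds ((hwo V).mem_nhds hV)] with q hq hqV
    exact ((hP q hq V).2.2 (subset_closure hqV)).2

theorem exists_continuous_height {Y : Type*} [TopologicalSpace Y] [T2Space Y] [ParacompactSpace Y]
    {N : Set (Y × ℝ≥0)} (hN : IsOpen N) (h0 : ∀ y, (y, 0) ∈ N) :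
    ∃ ε : C(Y, ℝ), ∀ y, 0 < ε y ∧ ∀ s : ℝ≥0, (s : ℝ) ≤ ε y → (y, s) ∈ N := by
  refine exists_continuous_forall_mem_convex_of_local_const
    (t := fun y => {c : ℝ | 0 < c ∧ ∀ s : ℝ≥0, (s : ℝ) ≤ c → (y, s) ∈ N}) (fun y => ?_)
    fun y => ?_
  · refine OrdConnected.convex ⟨fun c hc d hd x hx => ?_⟩
    exact ⟨hc.1.trans_le hx.1, fun s hs => hd.2 s (hs.trans hx.2)⟩
  · obtain ⟨t, ht, r, hr, htr⟩ := mem_nhds_prod_iff.1 (hN.mem_nhds (h0 y))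
    obtain ⟨a, ha, har⟩ := (NNReal.nhds_zero_basis.mem_iff).1 hr
    refine ⟨(a / 2 : ℝ≥0), ?_⟩
    filter_upwards [ht] with z hz
    refine ⟨by positivity, fun s hs => htr ⟨hz, har ?_⟩⟩
    exact lt_of_le_of_lt (NNReal.coe_le_coe.1 hs) (NNReal.half_lt_self ha.ne')

theorem IsCollared.of_injOn {B : Set X} [T2Space B] [ParacompactSpace B] {e : B × ℝ≥0 → X}
    {N : Set (B × ℝ≥0)} (hN : IsOpen N) (h0 : ∀ b, (b, 0) ∈ N) (hinj : InjOn e N)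
    (he : ∀ p ∈ N, ∃ Φ, IsCollarChart B Φ ∧ p ∈ Φ.source ∧ e =ᶠ[𝓝 p] Φ) : IsCollared B := by
  obtain ⟨ε, hε⟩ := exists_continuous_height hN h0
  have hopen : IsOpenEmbedding (N.domRestrict e) := by
    have hnhds : ∀ p : N, map (N.domRestrict e) (𝓝 p) = 𝓝 (e p) := fun p => by
      obtain ⟨Φ, -, hp, heq⟩ := he p p.2
      rw [domRestrict_eq, ← map_map, map_nhds_subtype_coe_eq_nhds p.2 (hN.mem_nhds p.2),
        map_congr heq, Φ.map_nhds_eq hp, heq.eq_of_nhds]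
    exact .of_continuous_injective_isOpenMap
      (continuous_iff_continuousAt.2 fun p => (hnhds p).le) hinj.injective
      (.of_nhds_le fun p => (hnhds p).ge)
  let j : B × I → N := fun q => ⟨(q.1, ⟨ε q.1 * q.2, mul_nonneg (hε q.1).1.le q.2.2.1⟩),
    (hε q.1).2 _ (mul_le_of_le_one_right (hε q.1).1.le q.2.2.2)⟩
  have hjc : Continuous j := by fun_prop
  have hj : IsEmbedding j := by
    let k : N → B × I := fun p => (p.1.1, projIcc 0 1 zero_le_one (p.1.2 / ε p.1.1))
    have hkc : Continuous k := by
      refine (continuous_fst.comp continuous_subtype_val).prodMk (continuous_projIcc.comp ?_)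
      exact Continuous.div (by fun_prop) (by fun_prop) fun p => (hε _).1.ne'
    refine Function.LeftInverse.isEmbedding (f := k) (fun q => ?_) hkc hjc
    refine Prod.ext rfl ?_
    have : ε q.1 * q.2 / ε q.1 = q.2 := mul_div_cancel_left₀ _ (hε q.1).1.ne'
    change projIcc 0 1 zero_le_one (ε q.1 * q.2 / ε q.1) = q.2
    rw [this, projIcc_val]
  have hjz : ∀ q, (j q).1.2 = 0 ↔ q.2 = 0 := fun q => by
    rw [← NNReal.coe_eq_zero]
    change ε q.1 * q.2 = 0 ↔ _
    simp [(hε q.1).1.ne']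
  have hval : ∀ p ∈ N, (p.2 = 0 → e p = p.1) ∧ (e p ∈ B → p.2 = 0) := fun p hp => by
    obtain ⟨Φ, hΦ, hpΦ, heq⟩ := he p hp
    rw [heq.eq_of_nhds]
    exact hΦ p hpΦ
  have hzero : ∀ q : B × I, q.2 = 0 → e (j q).1 = q.1 := fun q hq =>
    (hval _ (j q).2).1 ((hjz q).2 hq)
  refine ⟨N.domRestrict e ∘ j, hopen.isEmbedding.comp hj, fun x => hzero (x, 0) rfl, ?_, ?_⟩
  · ext q
    refine ⟨fun hq => (hjz q).1 ((hval _ (j q).2).2 hq), fun hq => ?_⟩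
    change e (j q).1 ∈ B
    rw [hzero q hq]
    exact q.1.2
  · rw [image_comp]
    refine hopen.isOpenMap _ ?_
    have himg : j '' {q | q.2 < 1} = {p : N | (p.1.2 : ℝ) < ε p.1.1} := by
      ext p
      constructor
      · rintro ⟨q, hq, rfl⟩
        exact mul_lt_of_lt_one_right (hε q.1).1 hq
      · intro hp
        have hpos := (hε p.1.1).1
        have hlt : (p.1.2 : ℝ) / ε p.1.1 < 1 := (div_lt_one hpos).2 hp
        refine ⟨(p.1.1, ⟨p.1.2 / ε p.1.1, by positivity, hlt.le⟩), hlt, ?_⟩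
        refine Subtype.ext (Prod.ext rfl (NNReal.coe_injective ?_))
        exact mul_div_cancel₀ _ hpos.ne'
    rw [himg]
    exact isOpen_lt (by fun_prop) (by fun_prop)

/-- (Connelly) If `B` is a closed subset of a Hausdorff space `M` which is locally collared
in `M` and strongly paracompact in `M`, then `B` is collared in `M`. -/
theorem collared_of_locallyCollared_stronglyParacompactIn {M : Type*} [TopologicalSpace M]
    [T2Space M] (B : Set M) (hB : IsClosed B)
    (hlc : IsLocallyCollared B) (hsp : StronglyParacompactIn B) :
    IsCollared B := by
  have := hsp.paracompactSpace
  obtain ⟨𝒰, ho, hcov, hcollar⟩ := hlc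
  obtain ⟨e, he⟩ := exists_forall_isCollarGermAt (B := B) fun b => by
    obtain ⟨U, hU, hb⟩ := hcov.ge (mem_univ b)
    obtain ⟨h, hh⟩ := hcollar U hU
    exact hh.exists_chart (ho U hU) hb
  obtain ⟨N, hN, h0, hinj, hchart⟩ := hsp.exists_injOn_of_isCollarGermAt hB he
  exact .of_injOn hN h0 hinj hchart
end

section
/- Let L_{≥0} be the closed long ray and let 𝕆 = {⟨x,y⟩ ∈ L_{≥0} × L_{≥0} : y ≤ x} be the closed octant with the subspace topology. Then 𝕆 is a normal 2-manifold with boundary, and its boundary ∂𝕆 (the set of points of 𝕆 with no neighbourhood homeomorphic to ℝ²) is not collared in 𝕆. -/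
open Set Topology

noncomputable section

def omega1 : Ordinal := (Cardinal.aleph 1).ord

abbrev Omega1 := ↥(Set.Iio omega1)

abbrev ClosedLongRay := Omega1 ×ₗ ↥(Set.Ico (0 : ℝ) 1)

instance : TopologicalSpace ClosedLongRay := Preorder.topology ClosedLongRay
instance : OrderTopology ClosedLongRay := ⟨rfl⟩

theorem omega1_pos : (0 : Ordinal) < omega1 := by
  rw [omega1, ← Cardinal.ord_zero]
  exact Cardinal.ord_lt_ord.mpr (Cardinal.aleph_pos 1)

def longRayZero : ClosedLongRay :=
  toLex (⟨0, omega1_pos⟩, ⟨0, by norm_num⟩)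

abbrev LongRayPlus := {x : ClosedLongRay // x ≠ longRayZero}

def ordPt (α : Omega1) : ClosedLongRay := toLex (α, ⟨0, by norm_num⟩)

open unitInterval

variable {X : Type*} [TopologicalSpace X]

/-- The closed octant `𝕆 = {⟨x,y⟩ ∈ L_{≥0} × L_{≥0} : y ≤ x}`, with the subspace topology. -/
abbrev Octant := {p : ClosedLongRay × ClosedLongRay // p.2 ≤ p.1}

theorem eq_of_continuous_of_exp_eq_const {f : ℝ → ℂ} (hf : Continuous f) {c : ℂ}
    (h : ∀ t, Complex.exp (f t) = c) (s t : ℝ) : f s = f t := by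
  have := Complex.isCoveringMap_exp.eq_of_comp_eq (g₁ := f) (g₂ := fun _ => f t) hf
    continuous_const (by ext u; simp [h]) t rfl
  exact congrFun this s

/-- A circle around the origin cannot be contracted in the punctured plane. -/
theorem not_exists_contraction_of_circle {G : ℝ × ℝ → ℂ} (hG : Continuous G)
    (h0 : ∀ p, G p ≠ 0) {c d : ℂ} (hstart : ∀ θ : ℝ, G (0, θ) = c * Complex.exp (θ * Complex.I))
    (hend : ∀ θ, G (1, θ) = d) (hper : ∀ s, G (s, 0) = G (s, 2 * Real.pi)) : False := by
  have hsc : IsSimplyConnected (univ : Set (ℝ × ℝ)) := by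
    have := convex_univ.contractibleSpace (univ_nonempty (α := ℝ × ℝ))
    exact SimplyConnectedSpace.ofContractible _
  obtain ⟨g, hg, hexp⟩ := Complex.exists_continuousOn_eqOn_exp_comp hsc
    isOpen_univ hG.continuousOn (by simpa using h0)
  rw [continuousOn_univ] at hg
  have hexp' : ∀ p, Complex.exp (g p) = G p := fun p => hexp (mem_univ p)
  have hc : c ≠ 0 := by
    intro hc
    exact h0 (0, 0) (by simp [hstart, hc])
  have h1 := eq_of_continuous_of_exp_eq_const (f := fun θ => g (1, θ)) (by fun_prop)
    (fun θ => (hexp' _).trans (hend θ)) 0 (2 * Real.pi)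
  have h2 := eq_of_continuous_of_exp_eq_const (f := fun θ => g (0, θ) - θ * Complex.I)
    (c := c) (by fun_prop)
    (fun θ => by rw [Complex.exp_sub, hexp', hstart, mul_div_cancel_right₀ _ (Complex.exp_ne_zero _)])
    0 (2 * Real.pi)
  have h3 := eq_of_continuous_of_exp_eq_const
    (f := fun s => g (s, 2 * Real.pi) - g (s, 0)) (c := 1) (by fun_prop)
    (fun s => by rw [Complex.exp_sub, hexp', hexp', hper, div_self (h0 _)]) 0 1
  have h4 : (2 * Real.pi : ℂ) * Complex.I = 0 := by
    push_cast at h2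
    linear_combination h3 + h2 - h1
  simp [Real.pi_ne_zero] at h4

theorem HasInteriorChart.exists_homeomorph_complex {Y : Type*} [TopologicalSpace Y] {x : Y}
    (h : HasInteriorChart 2 x) :
    ∃ U ∈ 𝓝 x, ∃ Ψ : U ≃ₜ ℂ, ∃ hx : x ∈ U, Ψ ⟨x, hx⟩ = 0 := by
  obtain ⟨U, hU, ⟨Ψ⟩⟩ := h
  let Ψ₁ : U ≃ₜ ℂ := (Ψ.trans Homeomorph.finTwoArrow).trans
    Complex.equivRealProdCLM.symm.toHomeomorph
  exact ⟨U, hU, Ψ₁.trans (Homeomorph.addRight (-Ψ₁ ⟨x, mem_of_mem_nhds hU⟩)),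
    mem_of_mem_nhds hU, by simp⟩

theorem not_hasInteriorChart_of_chart_snd_eq_zero {Y E : Type*} [TopologicalSpace Y]
    [NormedAddCommGroup E] [NormedSpace ℝ E] {V : Set Y} (hV : IsOpen V)
    (Φ : V ≃ₜ E × {r : ℝ // 0 ≤ r}) (x : V) (hx : ((Φ x).2 : ℝ) = 0) :
    ¬ HasInteriorChart 2 (x : Y) := by
  intro h
  obtain ⟨U, hU, Ψ, hxU, hΨ⟩ := h.exists_homeomorph_complex
  obtain ⟨r, hr, hrU⟩ : ∃ r > 0, ∀ q : E × {r : ℝ // 0 ≤ r}, q.1 ∈ Metric.ball (Φ x).1 r →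
      (q.2 : ℝ) < r → (Φ.symm q : Y) ∈ U := by
    have hc : ContinuousAt (fun q => (Φ.symm q : Y)) (Φ x) := by fun_prop
    have h1 : ∀ᶠ q in 𝓝 (Φ x), (Φ.symm q : Y) ∈ U := hc.eventually_mem (by simpa using hU)
    obtain ⟨r, hr, h2⟩ := Metric.eventually_nhds_iff_ball.1 h1
    refine ⟨r, hr, fun q hq hq' => h2 q ?_⟩
    rw [Metric.mem_ball, Prod.dist_eq, max_lt_iff]
    refine ⟨hq, ?_⟩
    rw [Subtype.dist_eq, Real.dist_eq, hx, sub_zero, abs_of_nonneg q.2.2]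
    exact hq'
  obtain ⟨ε, hε, hεV⟩ : ∃ ε > 0, ∀ z : ℂ, ‖z‖ ≤ ε → ∃ hz : (Ψ.symm z : Y) ∈ V,
      (Φ ⟨_, hz⟩).1 ∈ Metric.ball (Φ x).1 r ∧ ((Φ ⟨_, hz⟩).2 : ℝ) < r := by
    have hW : ∀ᶠ y in 𝓝 (x : Y), ∃ hy : y ∈ V,
        (Φ ⟨y, hy⟩).1 ∈ Metric.ball (Φ x).1 r ∧ ((Φ ⟨y, hy⟩).2 : ℝ) < r := by
      have h1 : ∀ᶠ v in 𝓝 x, (Φ v).1 ∈ Metric.ball (Φ x).1 r ∧ ((Φ v).2 : ℝ) < r := by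
        refine Filter.Eventually.and ?_ ?_
        · exact (show ContinuousAt (fun v => (Φ v).1) x by fun_prop).eventually_mem
            (Metric.ball_mem_nhds _ hr)
        · exact (show ContinuousAt (fun v => ((Φ v).2 : ℝ)) x by fun_prop).eventually_lt_const
            (by simpa only [hx] using hr)
      rw [← map_nhds_subtype_coe_eq_nhds x.2 (hV.mem_nhds x.2), Filter.eventually_map]
      exact h1.mono fun v hv => ⟨v.2, hv⟩
    have hc : ContinuousAt (fun z => (Ψ.symm z : Y)) 0 := by fun_prop
    have h0 : (Ψ.symm 0 : Y) = x := by rw [← hΨ]; simp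
    have h2 := hc.eventually (h0.symm ▸ hW)
    obtain ⟨ε, hε, h3⟩ := Metric.eventually_nhds_iff_ball.1 h2
    refine ⟨ε / 2, half_pos hε, fun z hz => h3 z ?_⟩
    rw [mem_ball_zero_iff]
    linarith
  let γ : ℝ → ℂ := fun θ => ε * Complex.exp (θ * Complex.I)
  have hγc : Continuous γ := by fun_prop
  have hγn : ∀ θ, ‖γ θ‖ = ε := fun θ => by
    simp [γ, Complex.norm_exp_ofReal_mul_I, abs_of_pos hε]
  have hγV : ∀ θ, ∃ hz : (Ψ.symm (γ θ) : Y) ∈ V,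
      (Φ ⟨_, hz⟩).1 ∈ Metric.ball (Φ x).1 r ∧ ((Φ ⟨_, hz⟩).2 : ℝ) < r := fun θ =>
    hεV _ (hγn θ).le
  choose hz hj₁ hj₂ using hγV
  let j : ℝ → E × {r : ℝ // 0 ≤ r} := fun θ => Φ ⟨_, hz θ⟩
  have hjc : Continuous j := by fun_prop
  let τ : ℝ → ℝ := fun s => max 0 (min s 1)
  have hτc : Continuous τ := by fun_prop
  have hτ0 : ∀ s, 0 ≤ τ s := fun s => le_max_left _ _
  have hτ1 : ∀ s, τ s ≤ 1 := fun s => max_le zero_le_one (min_le_right _ _)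
  let S : ℝ × ℝ → E × {r : ℝ // 0 ≤ r} := fun p =>
    ((1 - τ p.1) • (j p.2).1 + τ p.1 • (Φ x).1,
      ⟨(1 - τ p.1) * (j p.2).2 + τ p.1 * (r / 2),
        add_nonneg (mul_nonneg (sub_nonneg.2 (hτ1 _)) (j p.2).2.2)
          (mul_nonneg (hτ0 _) (half_pos hr).le)⟩)
  have hSc : Continuous S := by fun_prop
  have hSU : ∀ p, (Φ.symm (S p) : Y) ∈ U := fun p => by
    refine hrU _ ?_ ?_
    · exact convex_ball (Φ x).1 r (hj₁ p.2) (Metric.mem_ball_self hr)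
        (sub_nonneg.2 (hτ1 _)) (hτ0 _) (by ring)
    · exact convex_Iio r (hj₂ p.2) (half_lt_self hr)
        (sub_nonneg.2 (hτ1 _)) (hτ0 _) (by ring)
  have hS0 : ∀ θ, S (0, θ) = j θ := fun θ => by simp [S, τ]
  refine not_exists_contraction_of_circle (G := fun p => Ψ ⟨_, hSU p⟩) (by fun_prop)
    (fun p hp => ?_) (c := ε) (d := Ψ ⟨_, hSU (1, 0)⟩) (fun θ => ?_) (fun θ => ?_) (fun s => ?_)
  · have h1 : S p = Φ x := by
      rw [← hΨ, Ψ.injective.eq_iff, Subtype.mk.injEq, Subtype.coe_inj] at hp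
      rw [← hp]; simp
    have h2 : (1 - τ p.1) * (j p.2).2 + τ p.1 * (r / 2) = 0 := by
      exact (congrArg (fun q => (q.2 : ℝ)) h1).trans hx
    have h3 : τ p.1 = 0 := by
      have := mul_nonneg (sub_nonneg.2 (hτ1 p.1)) (j p.2).2.2
      have := mul_nonneg (hτ0 p.1) (half_pos hr).le
      have h4 : τ p.1 * (r / 2) = 0 := by linarith
      simpa [hr.ne'] using h4
    have h4 : j p.2 = Φ x := by
      rw [← h1]
      simp [S, h3]
    have h5 : Ψ.symm (γ p.2) = ⟨x, hxU⟩ := by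
      exact Subtype.ext (congrArg Subtype.val (Φ.injective h4) : (Ψ.symm (γ p.2) : Y) = x)
    have h6 : γ p.2 = 0 := by
      rw [← hΨ, ← h5]; simp
    have := hγn p.2
    rw [h6, norm_zero] at this
    exact hε.ne this
  · have : (⟨_, hSU (0, θ)⟩ : U) = Ψ.symm (γ θ) := Subtype.ext (by simp [hS0, j])
    simp only [this, Homeomorph.apply_symm_apply, γ]
  · congr 3
    simp [S, τ]
  · have : γ 0 = γ (2 * Real.pi) := by simp [γ]
    have h2 : j 0 = j (2 * Real.pi) := by simp only [j, this]
    congr 3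
    simp only [S, h2]

section WellOrder

variable {O : Type*} {w : O → ℝ}

theorem tsum_indicator_le_tsum_indicator (hw : Summable w) (hw0 : ∀ b, 0 ≤ w b) {s t : Set O}
    (hst : s ⊆ t) : ∑' c, s.indicator w c ≤ ∑' c, t.indicator w c :=
  (hw.indicator _).tsum_le_tsum (fun c => indicator_le_indicator_of_subset hst hw0 c)
    (hw.indicator _)

variable [LinearOrder O]

theorem tsum_indicator_Iic (hw : Summable w) (b : O) :
    ∑' c, (Iic b).indicator w c = ∑' c, (Iio b).indicator w c + w b := by
  have h : (Iic b).indicator w = (Iio b).indicator w + ({b} : Set O).indicator w := by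
    rw [← Iio_union_right, indicator_union_of_disjoint (by simp)]
    rfl
  simp only [h, Pi.add_apply]
  rw [(hw.indicator _).tsum_add (hw.indicator _), tsum_eq_single (f := ({b} : Set O).indicator w) b
    (fun c hc => by simp [hc])]
  simp

/-- A sum over an initial segment is bounded by any bound of the sums over smaller closed
initial segments. -/
theorem tsum_indicator_le_of_isLowerSet (hw : Summable w) (hw0 : ∀ b, 0 ≤ w b) {s : Set O}
    {r : ℝ} (hr : 0 ≤ r) (h : ∀ b ∈ s, ∑' c, (Iio b).indicator w c + w b ≤ r) :
    ∑' c, s.indicator w c ≤ r := by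
  classical
  refine (hw.indicator _).tsum_le_of_sum_le fun S => ?_
  rw [Finset.sum_indicator_eq_sum_filter]
  rcases (S.filter (· ∈ s)).eq_empty_or_nonempty with hS | hS
  · rw [hS, Finset.sum_empty]
    exact hr
  · have hm := Finset.max'_mem _ hS
    refine le_trans ?_ (h _ (Finset.mem_filter.1 hm).2)
    rw [← tsum_indicator_Iic hw]
    refine le_trans (le_of_eq ?_) ((hw.indicator _).sum_le_tsum (S.filter (· ∈ s))
      fun c _ => indicator_nonneg (fun c _ => hw0 c) c)
    exact Finset.sum_congr rfl fun c hc =>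
      (indicator_of_mem (mem_Iic.2 (Finset.le_max' _ c hc)) w).symm

/-- Replacing each point of a nonempty countable well-order by a half-open interval gives
a half-line. -/
theorem exists_orderIso_lex_Ico [WellFoundedLT O] [Countable O] [Nonempty O] :
    Nonempty (O ×ₗ Ico (0 : ℝ) 1 ≃o {r : ℝ // 0 ≤ r}) := by
  obtain ⟨w, hw0, hw⟩ : ∃ w : O → ℝ, (∀ b, 0 < w b) ∧ Summable w := by
    obtain ⟨e, he⟩ := exists_injective_nat O
    exact ⟨fun b => (1 / 2) ^ e b, fun b => by positivity,
      summable_geometric_two.comp_injective he⟩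
  have hw0' := fun b => (hw0 b).le
  let F : O → ℝ := fun b => ∑' c, (Iio b).indicator w c
  let T : ℝ := ∑' c, (univ : Set O).indicator w c
  let φ : O ×ₗ Ico (0 : ℝ) 1 → ℝ := fun p => F (ofLex p).1 + (ofLex p).2 * w (ofLex p).1
  have hF0 : ∀ b, 0 ≤ F b := fun b => tsum_nonneg (indicator_nonneg fun c _ => hw0' c)
  have hF : ∀ {b c}, b < c → F b + w b ≤ F c := fun {b c} h => by
    rw [← tsum_indicator_Iic hw]
    exact tsum_indicator_le_tsum_indicator hw hw0' (Iic_subset_Iio.2 h)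
  have hT : ∀ b, F b + w b ≤ T := fun b => by
    rw [← tsum_indicator_Iic hw]
    exact tsum_indicator_le_tsum_indicator hw hw0' (subset_univ _)
  have hφ0 : ∀ p, 0 ≤ φ p := fun p => add_nonneg (hF0 _) (mul_nonneg (ofLex p).2.2.1 (hw0' _))
  have hφ1 : ∀ p, φ p < F (ofLex p).1 + w (ofLex p).1 := fun p => by
    have := mul_lt_mul_of_pos_right (ofLex p).2.2.2 (hw0 (ofLex p).1)
    rw [one_mul] at this
    exact add_lt_add_right this _
  have hφT : ∀ p, φ p < T := fun p => (hφ1 p).trans_le (hT _)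
  have hφ : StrictMono φ := by
    intro p q hpq
    rcases Prod.Lex.lt_iff.1 hpq with h | ⟨h, h'⟩
    · calc φ p < F (ofLex p).1 + w (ofLex p).1 := hφ1 p
        _ ≤ F (ofLex q).1 := hF h
        _ ≤ φ q := le_add_of_nonneg_right (mul_nonneg (ofLex q).2.2.1 (hw0' _))
    · simp only [φ, h]
      exact add_lt_add_right (mul_lt_mul_of_pos_right (Subtype.coe_lt_coe.2 h') (hw0 _)) _
  have hφs : ∀ r, 0 ≤ r → r < T → ∃ p, φ p = r := by
    intro r hr hrT
    have hne : {b | r < F b + w b}.Nonempty := by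
      by_contra hne
      rw [not_nonempty_iff_eq_empty, eq_empty_iff_forall_notMem] at hne
      exact hrT.not_ge (tsum_indicator_le_of_isLowerSet hw hw0' hr
        fun b _ => not_lt.1 (hne b))
    let b := (wellFounded_lt (α := O)).min _ hne
    have hb : r < F b + w b := (wellFounded_lt (α := O)).min_mem _ hne
    have hFb : F b ≤ r := tsum_indicator_le_of_isLowerSet hw hw0' hr
      fun c hc => not_lt.1 fun h => (wellFounded_lt (α := O)).not_lt_min _ h hc
    refine ⟨toLex (b, ⟨(r - F b) / w b, div_nonneg (sub_nonneg.2 hFb) (hw0' b), ?_⟩), ?_⟩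
    · rw [div_lt_one (hw0 b)]
      linarith
    · simp only [φ, ofLex_toLex]
      rw [div_mul_cancel₀ _ (hw0 b).ne']
      ring
  refine ⟨StrictMono.orderIsoOfSurjective (fun p => ⟨φ p / (T - φ p),
    div_nonneg (hφ0 p) (sub_nonneg.2 (hφT p).le)⟩) ?_ ?_⟩
  · intro p q hpq
    rw [Subtype.mk_lt_mk]
    have := hφ hpq
    exact div_lt_div₀ this (by linarith) (hφ0 q) (sub_pos.2 (hφT q))
  · rintro ⟨s, hs⟩
    have hT0 : 0 < T := (hφ0 (toLex (Classical.arbitrary O, ⟨0, by norm_num⟩))).trans_lt (hφT _)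
    obtain ⟨p, hp⟩ := hφs (s * T / (1 + s)) (by positivity)
      (by rw [div_lt_iff₀ (by positivity)]; linarith)
    refine ⟨p, Subtype.ext ?_⟩
    simp only [hp]
    field_simp
    ring

end WellOrder

theorem lt_ordPt_iff {x : ClosedLongRay} {a : Omega1} : x < ordPt a ↔ (ofLex x).1 < a := by
  rw [Prod.Lex.lt_iff]
  refine ⟨fun h => h.resolve_right fun h' => ?_, Or.inl⟩
  exact (ofLex x).2.2.1.not_gt h'.2

instance countable_Iio_omega1 (a : Omega1) : Countable (Iio a) := by
  have h : (Iio (a : Ordinal)).Countable := by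
    have ha : (a : Ordinal) < (Cardinal.aleph 1).ord := a.2
    rw [Cardinal.lt_ord, Cardinal.lt_aleph_one_iff] at ha
    rwa [← Cardinal.le_aleph0_iff_set_countable, Cardinal.mk_Iio_ordinal,
      Cardinal.lift_le_aleph0]
  have := h.to_subtype
  exact Function.Injective.countable (f := fun b : Iio a => (⟨b.1.1, b.2⟩ : Iio (a : Ordinal)))
    fun b c h => Subtype.ext (Subtype.ext (Subtype.mk.inj h))

theorem exists_orderIso_Iio_ordPt {a : Omega1} (ha : ⟨0, omega1_pos⟩ < a) :
    Nonempty (Iio (ordPt a) ≃o {r : ℝ // 0 ≤ r}) := by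
  have : Nonempty (Iio a) := ⟨_, ha⟩
  obtain ⟨e⟩ := exists_orderIso_lex_Ico (O := Iio a)
  refine ⟨StrictMono.orderIsoOfSurjective (fun x => e (toLex
    (⟨(ofLex x.1).1, lt_ordPt_iff.1 x.2⟩, (ofLex x.1).2))) ?_ ?_⟩
  · refine e.strictMono.comp fun x y h => ?_
    rw [← Subtype.coe_lt_coe, Prod.Lex.lt_iff] at h
    rw [Prod.Lex.lt_iff]
    simpa [← Subtype.coe_inj, ← Subtype.coe_lt_coe] using h
  · refine e.surjective.comp fun p => ?_
    exact ⟨⟨toLex ((ofLex p).1.1, (ofLex p).2), lt_ordPt_iff.2 (ofLex p).1.2⟩, rfl⟩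

theorem isSuccLimit_omega1 : Order.IsSuccLimit omega1 :=
  Cardinal.isSuccLimit_ord (Cardinal.aleph0_le_aleph 1)

theorem exists_forall_lt_ordPt (z : ℕ → ClosedLongRay) :
    ∃ a : Omega1, ⟨0, omega1_pos⟩ < a ∧ ∀ n, z n < ordPt a := by
  have h : ⨆ n, ((ofLex (z n)).1 : Ordinal) < omega1 := by
    have hω : ∀ n, ((ofLex (z n)).1 : Ordinal) < omega1 := fun n => (ofLex (z n)).1.2
    simp only [omega1, Cardinal.ord_aleph] at hω ⊢
    exact Ordinal.iSup_lt_omega_one hω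
  refine ⟨⟨_, isSuccLimit_omega1.succ_lt h⟩, ?_, fun n => lt_ordPt_iff.2 ?_⟩
  · rw [← Subtype.coe_lt_coe]
    exact Order.bot_lt_succ _
  · rw [← Subtype.coe_lt_coe]
    exact Order.lt_succ_of_le (le_ciSup Ordinal.bddAbove_of_small n)

theorem exists_lt_ordPt (x : ClosedLongRay) : ∃ a : Omega1, ⟨0, omega1_pos⟩ < a ∧ x < ordPt a :=
  let ⟨a, ha, h⟩ := exists_forall_lt_ordPt fun _ => x
  ⟨a, ha, h 0⟩

instance : Nonempty ClosedLongRay := ⟨longRayZero⟩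

instance : NoMaxOrder ClosedLongRay := ⟨fun x => let ⟨a, _, h⟩ := exists_lt_ordPt x; ⟨ordPt a, h⟩⟩

theorem exists_homeomorph_Iio_ordPt {a : Omega1} (ha : ⟨0, omega1_pos⟩ < a) :
    ∃ e : Iio (ordPt a) ≃ₜ {r : ℝ // 0 ≤ r}, ∀ x y, e x ≤ e y ↔ x ≤ y := by
  obtain ⟨e⟩ := exists_orderIso_Iio_ordPt ha
  have : OrderTopology {r : ℝ // 0 ≤ r} := inferInstanceAs (OrderTopology (Ici (0 : ℝ)))
  exact ⟨e.toHomeomorph, fun x y => e.le_iff_le⟩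

theorem isCompact_Iic_closedLongRay (c : ClosedLongRay) : IsCompact (Iic c) := by
  obtain ⟨a, ha, hc⟩ := exists_lt_ordPt c
  obtain ⟨e, he⟩ := exists_homeomorph_Iio_ordPt ha
  have h : IsCompact (Iic (e ⟨c, hc⟩)) := by
    have h' : ∀ r : NNReal, IsCompact (Iic r) := fun r => by
      rw [← Icc_bot]
      exact isCompact_Icc
    exact h' _
  convert! (h.image e.symm.continuous).image continuous_subtype_val
  ext x
  simp only [mem_image, mem_Iic, exists_exists_and_eq_and]
  constructor
  · intro hx
    exact ⟨e ⟨x, hx.trans_lt hc⟩, (he _ _).2 hx, by simp⟩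
  · rintro ⟨r, hr, rfl⟩
    have := (he (e.symm r) ⟨c, hc⟩).1 (by simpa using hr)
    exact this

instance : WeaklyLocallyCompactSpace ClosedLongRay :=
  ⟨fun x => let ⟨y, hy⟩ := exists_gt x
    ⟨Iic y, isCompact_Iic_closedLongRay y, Iic_mem_nhds hy⟩⟩

instance : FirstCountableTopology ClosedLongRay := by
  refine ⟨fun x => ?_⟩
  obtain ⟨a, ha, hx⟩ := exists_lt_ordPt x
  obtain ⟨e, -⟩ := exists_homeomorph_Iio_ordPt ha
  have := e.isInducing.firstCountableTopology
  rw [← map_nhds_subtype_coe_eq_nhds (mem_Iio.2 hx) (Iio_mem_nhds hx)]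
  infer_instance

theorem Monotone.exists_tendsto_closedLongRay {z : ℕ → ClosedLongRay} (hz : Monotone z) :
    ∃ x, Filter.Tendsto z Filter.atTop (𝓝 x) := by
  obtain ⟨a, -, ha⟩ := exists_forall_lt_ordPt z
  have hc : IsCompact (closure (range z)) :=
    (isCompact_Iic_closedLongRay (ordPt a)).of_isClosed_subset isClosed_closure
      (closure_minimal (range_subset_iff.2 fun n => (ha n).le) isClosed_Iic)
  obtain ⟨x, -, hx⟩ := hc.exists_isLUB ((range_nonempty z).closure)
  exact ⟨x, tendsto_atTop_isLUB hz ⟨fun y hy => hx.1 (subset_closure hy),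
    fun y hy => hx.2 (closure_minimal hy isClosed_Iic)⟩⟩

/-- Sequences chosen in suitable neighbourhoods of a point of the one-point compactification of
the long ray always converge in the long ray itself. -/
theorem exists_nhds_selector (p : OnePoint ClosedLongRay) :
    ∃ N : ClosedLongRay → ℕ → Set ClosedLongRay,
      (∀ c n, N c n ∈ Filter.comap ((↑) : ClosedLongRay → OnePoint ClosedLongRay) (𝓝 p)) ∧
      ∀ z : ℕ → ClosedLongRay, (∀ n, z (n + 1) ∈ N (z n) n) →
        ∃ x, Filter.Tendsto z Filter.atTop (𝓝 x) := by
  induction p using OnePoint.rec with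
  | infty =>
    refine ⟨fun c _ => Ioi c, fun c _ => ?_, fun z hz => ?_⟩
    · simp only [OnePoint.comap_coe_nhds_infty, ← compl_Iic]
      exact (isCompact_Iic_closedLongRay c).compl_mem_coclosedCompact_of_isClosed isClosed_Iic
    · exact (strictMono_nat_of_lt_succ hz).monotone.exists_tendsto_closedLongRay
  | coe y =>
    obtain ⟨U, hU⟩ := (𝓝 y).exists_antitone_basis
    refine ⟨fun _ n => U n, fun _ n => ?_, fun z hz => ⟨y, ?_⟩⟩
    · rw [OnePoint.comap_coe_nhds]
      exact hU.mem n
    · rw [← Filter.tendsto_add_atTop_iff_nat 1]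
      exact hU.tendsto hz

theorem Topology.IsInducing.normalSpace_of_disjoint_closure {Y K : Type*} [TopologicalSpace Y]
    [TopologicalSpace K] [NormalSpace K] {f : Y → K} (hf : IsInducing f)
    (h : ∀ s t : Set Y, IsClosed s → IsClosed t → Disjoint s t →
      Disjoint (closure (f '' s)) (closure (f '' t))) : NormalSpace Y := by
  refine ⟨fun s t hs ht hst => ?_⟩
  have := normal_separation isClosed_closure isClosed_closure (h s t hs ht hst)
  exact (this.preimage hf.continuous).mono (image_subset_iff.1 subset_closure)
    (image_subset_iff.1 subset_closure)

instance normalSpace_closedLongRay_prod.{u} : NormalSpace (ClosedLongRay.{u} × ClosedLongRay.{u}) := by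
  let f : ClosedLongRay.{u} → OnePoint ClosedLongRay.{u} := (↑)
  have hf : IsEmbedding f := OnePoint.isOpenEmbedding_coe.isEmbedding
  refine (hf.prodMap hf).isInducing.normalSpace_of_disjoint_closure fun A B hA hB hAB => ?_
  rw [Set.disjoint_left]
  intro p hpA hpB
  obtain ⟨N₁, hN₁, hN₁'⟩ := exists_nhds_selector p.1
  obtain ⟨N₂, hN₂, hN₂'⟩ := exists_nhds_selector p.2
  have key : ∀ C : Set (ClosedLongRay × ClosedLongRay), p ∈ closure (Prod.map f f '' C) →
      ∀ (c : ClosedLongRay × ClosedLongRay) (n : ℕ),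
        ∃ a ∈ C, a.1 ∈ N₁ c.1 n ∧ a.2 ∈ N₂ c.2 n := by
    intro C hC c n
    obtain ⟨W₁, hW₁, h₁⟩ := hN₁ c.1 n
    obtain ⟨W₂, hW₂, h₂⟩ := hN₂ c.2 n
    obtain ⟨_, ⟨hW, ⟨a, ha, rfl⟩⟩⟩ := mem_closure_iff_nhds.1 hC _ (prod_mem_nhds hW₁ hW₂)
    exact ⟨a, ha, h₁ hW.1, h₂ hW.2⟩
  choose g hg hg' using key A hpA
  choose k hk hk' using key B hpB
  let z : ℕ → ClosedLongRay × ClosedLongRay := fun n =>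
    Nat.rec (longRayZero, longRayZero) (fun n c => if Even n then g c n else k c n) n
  have hz : ∀ n, z (n + 1) = if Even n then g (z n) n else k (z n) n := fun n => rfl
  have hzN : ∀ n, (z (n + 1)).1 ∈ N₁ (z n).1 n ∧ (z (n + 1)).2 ∈ N₂ (z n).2 n := by
    intro n
    rw [hz]
    split_ifs
    exacts [hg' _ _, hk' _ _]
  obtain ⟨x, hx⟩ := hN₁' (fun n => (z n).1) fun n => (hzN n).1
  obtain ⟨y, hy⟩ := hN₂' (fun n => (z n).2) fun n => (hzN n).2
  have hlim : Filter.Tendsto z Filter.atTop (𝓝 (x, y)) := hx.prodMk_nhds hy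
  refine hAB.notMem_of_mem_left (a := (x, y)) ?_ ?_
  · refine hA.mem_of_frequently_of_tendsto (Filter.frequently_atTop.2 fun n => ?_) hlim
    refine ⟨2 * n + 1, by omega, ?_⟩
    rw [hz, if_pos (even_two_mul n)]
    exact hg _ _
  · refine hB.mem_of_frequently_of_tendsto (Filter.frequently_atTop.2 fun n => ?_) hlim
    refine ⟨2 * n + 1 + 1, by omega, ?_⟩
    rw [hz, if_neg (by simp [parity_simps])]
    exact hk _ _

/-- Initial parts of the octant are half-planes, with the diagonal on the boundary line. -/
theorem exists_octant_chart {a : Omega1} (ha : ⟨0, omega1_pos⟩ < a) :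
    ∃ Φ : {p : Octant | p.1.1 < ordPt a} ≃ₜ (Fin 1 → ℝ) × {r : ℝ // 0 ≤ r},
      ∀ p, p.1.1.1 = p.1.1.2 → ((Φ p).2 : ℝ) = 0 := by
  obtain ⟨e, he⟩ := exists_homeomorph_Iio_ordPt ha
  let u : {p : Octant | p.1.1 < ordPt a} → {r : ℝ // 0 ≤ r} := fun p => e ⟨p.1.1.1, p.2⟩
  let v : {p : Octant | p.1.1 < ordPt a} → {r : ℝ // 0 ≤ r} :=
    fun p => e ⟨p.1.1.2, p.1.2.trans_lt p.2⟩
  have hvu : ∀ p, (v p : ℝ) ≤ u p := fun p => (he _ _).2 p.1.2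
  have hu : Continuous u := by fun_prop
  have hv : Continuous v := by fun_prop
  let V : (Fin 1 → ℝ) × {r : ℝ // 0 ≤ r} → {r : ℝ // 0 ≤ r} := fun q =>
    ⟨q.2 + max (-q.1 0) 0, add_nonneg q.2.2 (le_max_right _ _)⟩
  let U : (Fin 1 → ℝ) × {r : ℝ // 0 ≤ r} → {r : ℝ // 0 ≤ r} := fun q =>
    ⟨2 * q.2 + |q.1 0|, add_nonneg (mul_nonneg zero_le_two q.2.2) (abs_nonneg _)⟩
  have hVU : ∀ q, V q ≤ U q := fun q => by
    have := q.2.2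
    refine Subtype.coe_le_coe.1 ?_
    simp only [V, U]
    linarith [max_le (neg_le_abs (q.1 0)) (abs_nonneg (q.1 0))]
  have hU : Continuous U := by fun_prop
  have hV : Continuous V := by fun_prop
  refine ⟨⟨⟨fun p => (fun _ => u p - 2 * v p,
      ⟨min (u p - v p) (v p), le_min (sub_nonneg.2 (hvu p)) (v p).2⟩),
    fun q => ⟨⟨(e.symm (U q), e.symm (V q)), ?_⟩, (e.symm (U q)).2⟩, fun p => ?_, fun q => ?_⟩,
    by fun_prop, ?_⟩, fun p hp => ?_⟩
  · rw [Subtype.coe_le_coe, ← he]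
    simpa using hVU q
  · have h := hvu p
    have h1 : U (fun _ => u p - 2 * v p,
        ⟨min (u p - v p) (v p), le_min (sub_nonneg.2 (hvu p)) (v p).2⟩) = u p := by
      refine Subtype.ext ?_
      simp only [U]
      rcases le_total (u p - v p : ℝ) (v p) with h' | h'
      · rw [min_eq_left h', abs_of_nonpos (by linarith)]; ring
      · rw [min_eq_right h', abs_of_nonneg (by linarith)]; ring
    have h2 : V (fun _ => u p - 2 * v p,
        ⟨min (u p - v p) (v p), le_min (sub_nonneg.2 (hvu p)) (v p).2⟩) = v p := by
      refine Subtype.ext ?_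
      simp only [V]
      rcases le_total (u p - v p : ℝ) (v p) with h' | h'
      · rw [min_eq_left h', max_eq_left (by linarith)]; ring
      · rw [min_eq_right h', max_eq_right (by linarith)]; ring
    refine Subtype.ext (Subtype.ext (Prod.ext ?_ ?_))
    · simp only [h1]
      simp [u]
    · simp only [h2]
      simp [v]
  · obtain ⟨s, t, ht⟩ := q
    have h1 : u ⟨⟨(e.symm (U (s, ⟨t, ht⟩)), e.symm (V (s, ⟨t, ht⟩))), by
      rw [Subtype.coe_le_coe, ← he]
      simpa using hVU _⟩, (e.symm (U (s, ⟨t, ht⟩))).2⟩ = U (s, ⟨t, ht⟩) :=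
      e.apply_symm_apply _
    have h2 : v ⟨⟨(e.symm (U (s, ⟨t, ht⟩)), e.symm (V (s, ⟨t, ht⟩))), by
      rw [Subtype.coe_le_coe, ← he]
      simpa using hVU _⟩, (e.symm (U (s, ⟨t, ht⟩))).2⟩ = V (s, ⟨t, ht⟩) :=
      e.apply_symm_apply _
    refine Prod.ext (funext fun i => ?_) (Subtype.ext ?_)
    · rw [Subsingleton.elim i 0]
      simp only [h1, h2, U, V]
      rcases le_total (s 0) 0 with h | h
      · rw [abs_of_nonpos h, max_eq_left (by linarith)]; ring
      · rw [abs_of_nonneg h, max_eq_right (by linarith)]; ring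
    · simp only [h1, h2, U, V]
      rcases le_total (s 0) 0 with h | h
      · rw [abs_of_nonpos h, max_eq_left (by linarith), min_eq_left (by linarith)]; ring
      · rw [abs_of_nonneg h, max_eq_right (by linarith), min_eq_right (by linarith)]; ring
  · have h1 : Continuous fun q => e.symm (U q) := e.symm.continuous.comp hU
    have h2 : Continuous fun q => e.symm (V q) := e.symm.continuous.comp hV
    exact (((continuous_subtype_val.comp h1).prodMk
      (continuous_subtype_val.comp h2)).subtype_mk _).subtype_mk _
  · have : u p = v p := congrArg e (Subtype.ext hp)
    simpa [this] using (v p).2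

theorem isOpen_octant_part (a : Omega1) : IsOpen {p : Octant | p.1.1 < ordPt a} :=
  isOpen_Iio.preimage (by fun_prop : Continuous fun p : Octant => p.1.1)

theorem isManifoldWithBoundary_octant : IsManifoldWithBoundary 2 Octant := by
  intro p
  obtain ⟨a, ha, hp⟩ := exists_lt_ordPt p.1.1
  obtain ⟨Φ, -⟩ := exists_octant_chart ha
  exact ⟨_, (isOpen_octant_part a).mem_nhds hp, ⟨Φ⟩⟩

theorem diag_mem_mBoundary_octant (x : ClosedLongRay) :
    (⟨(x, x), le_rfl⟩ : Octant) ∈ mBoundary 2 Octant := by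
  obtain ⟨a, ha, hx⟩ := exists_lt_ordPt x
  obtain ⟨Φ, hΦ⟩ := exists_octant_chart ha
  exact not_hasInteriorChart_of_chart_snd_eq_zero (isOpen_octant_part a) Φ ⟨⟨(x, x), le_rfl⟩, hx⟩
    (hΦ _ rfl)

/-- Two self-maps of the long ray, the smaller of which is unbounded, have a common fixed point. -/
theorem exists_common_fixedPoint {f g : ClosedLongRay → ClosedLongRay} (hf : Continuous f)
    (hg : Continuous g) (hgf : ∀ x, g x ≤ f x) (h : ∀ c, ∃ x, c < g x) :
    ∃ x, f x = x ∧ g x = x := by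
  have step : ∀ c : ClosedLongRay, ∃ x, c < x ∧ c < g x := by
    intro c
    obtain ⟨b, hb⟩ := ((isCompact_Iic_closedLongRay c).image hg).bddAbove
    obtain ⟨x, hx⟩ := h (max b c)
    refine ⟨x, ?_, (le_max_right _ _).trans_lt hx⟩
    by_contra hxc
    exact ((le_max_left b c).trans_lt hx).not_ge (hb ⟨x, not_lt.1 hxc, rfl⟩)
  choose y hy hgy using step
  have bound : ∀ c, ∃ c', y c < c' ∧ f (y c) < c' := fun c =>
    let ⟨c', h'⟩ := exists_gt (max (y c) (f (y c)))
    ⟨c', max_lt_iff.1 h'⟩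
  choose k hk hfk using bound
  let z : ℕ → ClosedLongRay := fun n => k^[n] longRayZero
  have hz : ∀ n, z (n + 1) = k (z n) := fun n => Function.iterate_succ_apply' k n _
  have hzm : StrictMono z := strictMono_nat_of_lt_succ fun n => by
    rw [hz]
    exact (hy _).trans (hk _)
  obtain ⟨x, hx⟩ := hzm.monotone.exists_tendsto_closedLongRay
  have hx' : Filter.Tendsto (fun n => z (n + 1)) Filter.atTop (𝓝 x) :=
    (Filter.tendsto_add_atTop_iff_nat 1).2 hx
  have squeeze : ∀ q : ℕ → ClosedLongRay, (∀ n, z n ≤ q n) → (∀ n, q n ≤ z (n + 1)) →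
      Filter.Tendsto q Filter.atTop (𝓝 x) := fun q h₁ h₂ =>
    tendsto_of_tendsto_of_tendsto_of_le_of_le hx hx' h₁ h₂
  have hyx := squeeze (fun n => y (z n)) (fun n => (hy _).le) fun n => by
    rw [hz]; exact (hk _).le
  have hfx := squeeze (fun n => f (y (z n))) (fun n => ((hgy _).trans_le (hgf _)).le) fun n => by
    rw [hz]; exact (hfk _).le
  have hgx := squeeze (fun n => g (y (z n))) (fun n => (hgy _).le) fun n => by
    rw [hz]; exact ((hgf _).trans_lt (hfk _)).le
  exact ⟨x, tendsto_nhds_unique ((hf.tendsto x).comp hyx) hfx,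
    tendsto_nhds_unique ((hg.tendsto x).comp hyx) hgx⟩

theorem not_isCollared_mBoundary_octant : ¬ IsCollared (mBoundary 2 Octant) := by
  rintro ⟨h, hemb, h0, hB, -⟩
  let δ : ClosedLongRay → mBoundary 2 Octant := fun x => ⟨_, diag_mem_mBoundary_octant x⟩
  have hδ : Continuous δ := by fun_prop
  have hc := hemb.continuous
  have hbdd : ∀ t : I, t ≠ 0 → ∃ c, ∀ x, (h (δ x, t)).1.2 ≤ c := by
    intro t ht
    by_contra! hub
    obtain ⟨x, hx₁, hx₂⟩ := exists_common_fixedPoint (f := fun x => (h (δ x, t)).1.1)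
      (g := fun x => (h (δ x, t)).1.2) (by fun_prop) (by fun_prop) (fun x => (h (δ x, t)).2) hub
    have hx : h (δ x, t) = δ x := Subtype.ext (Prod.ext hx₁ hx₂)
    have : (δ x, t) ∈ h ⁻¹' mBoundary 2 Octant := by
      rw [mem_preimage, hx]
      exact (δ x).2
    rw [hB] at this
    exact ht this
  let t : ℕ → I := fun n => ⟨1 / ((n : ℝ) + 1), by positivity,
    by rw [div_le_one (by positivity)]; linarith [n.cast_nonneg (α := ℝ)]⟩
  have ht0 : ∀ n, t n ≠ 0 := fun n hn => by
    have : (1 : ℝ) / (n + 1) = 0 := congrArg Subtype.val hn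
    exact (by positivity : (1 : ℝ) / (n + 1) ≠ 0) this
  have htl : Filter.Tendsto t Filter.atTop (𝓝 0) :=
    tendsto_subtype_rng.2 tendsto_one_div_add_atTop_nhds_zero_nat
  choose c hc' using fun n => hbdd (t n) (ht0 n)
  obtain ⟨a, -, ha⟩ := exists_forall_lt_ordPt c
  obtain ⟨x, hx⟩ := exists_gt (ordPt a)
  have hlim : Filter.Tendsto (fun n => (h (δ x, t n)).1.2) Filter.atTop (𝓝 (h (δ x, 0)).1.2) :=
    ((by fun_prop : Continuous fun s => (h (δ x, s)).1.2).tendsto 0).comp htl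
  have hle := le_of_tendsto' hlim fun n => (hc' n x).trans (ha n).le
  rw [h0] at hle
  exact hx.not_ge hle

/-- The closed octant is a normal (Hausdorff) 2-manifold with boundary whose boundary is not
collared. -/
theorem octant_normal_manifold_boundary_not_collared :
    T2Space Octant ∧ NormalSpace Octant ∧ IsManifoldWithBoundary 2 Octant ∧
      ¬ IsCollared (mBoundary 2 Octant) := by
  have hcl : IsClosed {p : ClosedLongRay × ClosedLongRay | p.2 ≤ p.1} :=
    isClosed_le continuous_snd continuous_fst
  exact ⟨inferInstance, hcl.isClosedEmbedding_subtypeVal.normalSpace,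
    isManifoldWithBoundary_octant, not_isCollared_mBoundary_octant⟩
end
end
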